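/- arXiv:1809.00401 — 2 statements merged into one kernel-verified Lean document; each statement's English description precedes it below -/
import Mathlib

section
/- Every Darboux injection f : X → Y from a nonempty compact connected metrizable space X to a 1-manifold Y is a topological embedding, i.e., a homeomorphism of X onto its image with the subspace topology. -/
open Set Filter Topology

/-- Boundary bumping: in a compact connected Hausdorff space, the closure of each component of the
complement of a nonempty closed set meets that closed set. -/
theorem closure_connectedComponentIn_compl_inter_nonempty {X : Type*} [TopologicalSpace X]
    [CompactSpace X] [PreconnectedSpace X] [T2Space X] {F : Set X} (hF : IsClosed F)
    (hne : F.Nonempty) {x : X} (hx : x ∉ F) :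
    (closure (connectedComponentIn Fᶜ x) ∩ F).Nonempty := by
  by_contra hempty
  obtain ⟨V, hV, hCV, hVF⟩ := normal_exists_closure_subset isClosed_closure hF.isOpen_compl
    fun z hz hzF => hempty ⟨z, hz, hzF⟩
  have hxC : x ∈ connectedComponentIn Fᶜ x := mem_connectedComponentIn hx
  have hxK : x ∈ closure V := subset_closure (hCV (subset_closure hxC))
  have : CompactSpace (closure V) := isCompact_iff_compactSpace.1 isClosed_closure.isCompact
  let ξ : closure V := ⟨x, hxK⟩
  obtain ⟨⟨Z, hZ, hξZ⟩, hZV⟩ : ∃ Z : { Z : Set (closure V) // IsClopen Z ∧ ξ ∈ Z },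
      Z.1 ⊆ Subtype.val ⁻¹' V := by
    have : Nonempty { Z : Set (closure V) // IsClopen Z ∧ ξ ∈ Z } :=
      ⟨⟨univ, isClopen_univ, mem_univ _⟩⟩
    refine exists_subset_nhds_of_compactSpace ?_ (fun Z => Z.2.1.1) fun z hz => ?_
    · rintro ⟨s, hs, hxs⟩ ⟨t, ht, hxt⟩
      exact ⟨⟨s ∩ t, hs.inter ht, ⟨hxs, hxt⟩⟩, inter_subset_left, inter_subset_right⟩
    · rw [← connectedComponent_eq_iInter_isClopen] at hz
      refine (hV.preimage continuous_subtype_val).mem_nhds (hCV (subset_closure ?_))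
      refine connectedComponentIn_mono x hVF ?_
      rw [connectedComponentIn_eq_image hxK]
      exact mem_image_of_mem _ hz
  obtain ⟨O, hO, hOZ⟩ := isOpen_induced_iff.1 hZ.isOpen
  have hZO : Subtype.val '' Z = O ∩ V := by
    ext z
    constructor
    · rintro ⟨w, hw, rfl⟩
      exact ⟨by rw [← hOZ] at hw; exact hw, hZV hw⟩
    · rintro ⟨hzO, hzV⟩
      exact ⟨⟨z, subset_closure hzV⟩, by rw [← hOZ]; exact hzO, rfl⟩
  have hclopen : IsClopen (Subtype.val '' Z : Set X) :=
    ⟨isClosed_closure.isClosedEmbedding_subtypeVal.isClosedMap _ hZ.isClosed,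
      hZO ▸ hO.inter hV⟩
  obtain ⟨p, hp⟩ := hne
  have hpZ : p ∈ (Subtype.val '' Z : Set X) := by
    rw [hclopen.eq_univ ⟨x, ξ, hξZ, rfl⟩]
    trivial
  rw [hZO] at hpZ
  exact hVF (subset_closure hpZ.2) hp

/-- If a closed set has a complement with finitely many components, these components are open. -/
theorem isOpen_connectedComponentIn_compl_of_finite {X : Type*} [TopologicalSpace X] {F : Set X}
    (hF : IsClosed F) (hfin : (connectedComponentIn Fᶜ '' Fᶜ).Finite) (x : X) :
    IsOpen (connectedComponentIn Fᶜ x) := by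
  by_cases hx : x ∈ Fᶜ
  swap
  · simp [connectedComponentIn_eq_empty hx]
  have hclosed : ∀ z ∈ Fᶜ, IsClosed (F ∪ connectedComponentIn Fᶜ z) := by
    refine fun z hz => isClosed_of_closure_subset fun w hw => ?_
    rw [closure_union, hF.closure_eq] at hw
    by_cases hwF : w ∈ F
    · exact Or.inl hwF
    refine Or.inr ((isPreconnected_connectedComponentIn.subset_closure (subset_insert w _)
      (insert_subset (hw.resolve_left hwF) subset_closure)).subset_connectedComponentIn
      (mem_insert_of_mem _ (mem_connectedComponentIn hz))
      (insert_subset hwF (connectedComponentIn_subset _ _)) (mem_insert w _))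
  have hrest : IsClosed (F ∪ ⋃ C ∈ (connectedComponentIn Fᶜ '' Fᶜ) \ {connectedComponentIn Fᶜ x},
      (F ∪ C)) := by
    refine hF.union ((hfin.subset sdiff_subset).isClosed_biUnion ?_)
    rintro _ ⟨⟨z, hz, rfl⟩, -⟩
    exact hclosed z hz
  convert hrest.isOpen_compl using 1
  ext w
  constructor
  · rintro hw (hwF | hwC)
    · exact connectedComponentIn_subset _ _ hw hwF
    · simp only [mem_iUnion] at hwC
      obtain ⟨_, ⟨⟨z, hz, rfl⟩, hne⟩, hwF | hwz⟩ := hwC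
      · exact connectedComponentIn_subset _ _ hw hwF
      · exact hne ((connectedComponentIn_eq hwz).trans (connectedComponentIn_eq hw).symm)
  · intro hw
    by_contra hwx
    have hwF : w ∈ Fᶜ := fun h => hw (Or.inl h)
    refine hw (Or.inr (mem_biUnion ⟨mem_image_of_mem _ hwF, fun h => hwx ?_⟩
      (Or.inr (mem_connectedComponentIn hwF))))
    rw [← mem_singleton_iff.1 h]
    exact mem_connectedComponentIn hwF

/-- A preconnected set which accumulates at `y`, in a linearly ordered chart, from the right, but
does not contain `y`, contains a right germ at `y`. -/
theorem IsPreconnected.mem_map_symm_nhdsGT {Y α : Type*} [TopologicalSpace Y] [T2Space Y]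
    [LinearOrder α] [TopologicalSpace α] [OrderTopology α] [CompactIccSpace α]
    (e : OpenPartialHomeomorph Y α) {y : Y} (hy : y ∈ e.source) {D : Set Y}
    (hD : IsPreconnected D) (hyD : y ∉ D)
    (hacc : e y ∈ closure (e '' (e.source ∩ D) ∩ Ioi (e y))) :
    (map e.symm (𝓝[>] (e y))).NeBot ∧ D ∈ map e.symm (𝓝[>] (e y)) := by
  have hne : (𝓝[>] (e y)).NeBot :=
    mem_closure_iff_nhdsWithin_neBot.1 (closure_mono inter_subset_right hacc)
  refine ⟨hne.map _, ?_⟩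
  obtain ⟨b, -, hb⟩ := closure_nonempty_iff.1 ⟨_, hacc⟩
  obtain ⟨u, hu, hut⟩ := exists_Ico_subset_of_mem_nhds (e.open_target.mem_nhds (e.map_source hy))
    ⟨b, hb⟩
  obtain ⟨d, hdu, ⟨d', hd', rfl⟩, htd⟩ := mem_closure_iff.1 hacc (Iio u) isOpen_Iio hu
  rw [mem_map]
  filter_upwards [Ioo_mem_nhdsGT htd] with c hc
  by_contra hcD
  have hIcc : Icc (e y) c ⊆ e.target := fun z hz => hut ⟨hz.1, hz.2.trans_lt (hc.2.trans hdu)⟩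
  have hIoo : Ioo (e y) c ⊆ e.target := Ioo_subset_Icc_self.trans hIcc
  have hopen : IsOpen (e.symm '' Ioo (e y) c) := e.isOpen_image_symm_of_subset_target isOpen_Ioo hIoo
  have hclosed : IsClosed (e.symm '' Icc (e y) c) :=
    (isCompact_Icc.image_of_continuousOn (e.continuousOn_symm.mono hIcc)).isClosed
  obtain ⟨a, hac, ⟨a', ha', rfl⟩, hta⟩ := mem_closure_iff.1 hacc (Iio c) isOpen_Iio hc.1
  have hsub : D ⊆ e.symm '' Ioo (e y) c := by
    refine hD.subset_of_closure_inter_subset hopen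
      ⟨a', ha'.2, e a', ⟨hta, hac⟩, e.left_inv ha'.1⟩ ?_
    rintro w ⟨hw, hwD⟩
    obtain ⟨s, hs, rfl⟩ := closure_minimal (image_mono Ioo_subset_Icc_self) hclosed hw
    refine mem_image_of_mem _ ⟨hs.1.lt_of_ne ?_, hs.2.lt_of_ne ?_⟩
    · rintro rfl
      exact hyD (by rwa [e.left_inv hy] at hwD)
    · rintro rfl
      exact hcD hwD
  obtain ⟨s, hs, hsd⟩ := hsub hd'.2
  rw [← hsd, e.right_inv (hIoo hs)] at hc
  exact lt_asymm hs.2 hc.2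

/-- A point with a linearly ordered chart has two germs such that every preconnected set
accumulating at the point without containing it contains one of them. -/
theorem exists_filter_of_isPreconnected_of_mem_closure {Y α : Type*} [TopologicalSpace Y]
    [T2Space Y] [LinearOrder α] [TopologicalSpace α] [OrderTopology α] [CompactIccSpace α]
    (e : OpenPartialHomeomorph Y α) {y : Y} (hy : y ∈ e.source) :
    ∃ L : Bool → Filter Y, ∀ D : Set Y, IsPreconnected D → y ∉ D → y ∈ closure D →
      ∃ i, (L i).NeBot ∧ D ∈ L i := by
  let e' : OpenPartialHomeomorph Y αᵒᵈ := e
  refine ⟨fun i => bif i then map e.symm (𝓝[>] (e y)) else map e'.symm (𝓝[>] (e' y)),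
    fun D hD hyD hcl => ?_⟩
  have hacc : e y ∈ closure (e '' (e.source ∩ D)) := by
    have hcl' : y ∈ closure (e.source ∩ D) := e.open_source.inter_closure ⟨hy, hcl⟩
    exact (e.continuousAt hy).continuousWithinAt.mem_closure_image hcl'
  have hsplit : e '' (e.source ∩ D) ⊆
      (e '' (e.source ∩ D) ∩ Ioi (e y)) ∪ (e '' (e.source ∩ D) ∩ Iio (e y)) := by
    rintro _ ⟨z, hz, rfl⟩
    have hzy : e z ≠ e y := fun h => hyD (e.injOn hz.1 hy h ▸ hz.2)
    rcases hzy.lt_or_gt with h | h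
    · exact Or.inr ⟨⟨z, hz, rfl⟩, h⟩
    · exact Or.inl ⟨⟨z, hz, rfl⟩, h⟩
  have := closure_mono hsplit hacc
  rw [closure_union] at this
  rcases this with h | h
  · exact ⟨true, hD.mem_map_symm_nhdsGT e hy hyD h⟩
  · exact ⟨false, hD.mem_map_symm_nhdsGT e' hy hyD h⟩

/-- A neighborhood of a point with a chart in `[0, ∞)` contains an open neighborhood with finite
frontier. -/
theorem exists_isOpen_finite_frontier_subset {Y : Type*} [TopologicalSpace Y] [T2Space Y]
    (e : OpenPartialHomeomorph Y (Ici (0 : ℝ))) {y : Y} (hy : y ∈ e.source) {N : Set Y}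
    (hN : N ∈ 𝓝 y) : ∃ J ⊆ N, IsOpen J ∧ y ∈ J ∧ (frontier J).Finite := by
  have : ProperSpace (Ici (0 : ℝ)) := ProperSpace.of_isClosed isClosed_Ici
  have hnhds : e.target ∩ e.symm ⁻¹' N ∈ 𝓝 (e y) :=
    inter_mem (e.open_target.mem_nhds (e.map_source hy))
      ((e.continuousAt_symm (e.map_source hy)).preimage_mem_nhds (by rwa [e.left_inv hy]))
  obtain ⟨r, hr, hsub⟩ := Metric.nhds_basis_closedBall.mem_iff.1 hnhds
  have hball : Metric.ball (e y) r ⊆ Metric.closedBall (e y) r := Metric.ball_subset_closedBall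
  have htarget : Metric.closedBall (e y) r ⊆ e.target := hsub.trans inter_subset_left
  have hopen : IsOpen (e.symm '' Metric.ball (e y) r) :=
    e.isOpen_image_symm_of_subset_target Metric.isOpen_ball (hball.trans htarget)
  have hclosed : IsClosed (e.symm '' Metric.closedBall (e y) r) :=
    ((isCompact_closedBall _ _).image_of_continuousOn
      (e.continuousOn_symm.mono htarget)).isClosed
  have hsphere : (Metric.sphere (e y) r).Finite := by
    refine Finite.of_finite_image (f := Subtype.val)
      ((Set.toFinite {(e y : ℝ) + r, (e y : ℝ) - r}).subset ?_) Subtype.val_injective.injOn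
    rintro _ ⟨z, hz, rfl⟩
    rw [Metric.mem_sphere, Subtype.dist_eq, Real.dist_eq] at hz
    rcases abs_choice ((z : ℝ) - e y) with h | h
    · exact Or.inl (by linarith)
    · exact Or.inr (by rw [mem_singleton_iff]; linarith)
  refine ⟨_, ?_, hopen, ⟨e y, Metric.mem_ball_self hr, e.left_inv hy⟩,
    (hsphere.image e.symm).subset ?_⟩
  · rintro _ ⟨z, hz, rfl⟩
    exact (hsub (hball hz)).2
  · rw [hopen.frontier_eq]
    rintro w ⟨hw, hwJ⟩
    obtain ⟨s, hs, rfl⟩ := closure_minimal (image_mono hball) hclosed hw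
    refine mem_image_of_mem _ (le_antisymm hs (not_lt.1 fun h => hwJ (mem_image_of_mem _ h)))

/-- A Darboux map sends an accumulation point of a nonempty preconnected set into the closure of
the image of that set. -/
theorem mem_closure_image_of_isPreconnected {X Y : Type*} [TopologicalSpace X] [TopologicalSpace Y]
    [T1Space Y] {f : X → Y}
    (hf : ∀ C : Set X, IsPreconnected C → IsPreconnected (f '' C)) {C : Set X}
    (hC : IsPreconnected C) {p : X} (hp : p ∈ closure C) : f p ∈ closure (f '' C) := by
  by_contra hcl
  obtain ⟨c, hc⟩ := closure_nonempty_iff.1 ⟨p, hp⟩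
  have hcp : f c ≠ f p := fun h => hcl (h ▸ subset_closure (mem_image_of_mem f hc))
  obtain ⟨_, ⟨z, rfl | hz, rfl⟩, hz₁, hz₂⟩ := hf (insert p C)
    (hC.subset_closure (subset_insert p C) (insert_subset hp subset_closure))
    (closure (f '' C))ᶜ {f p}ᶜ isClosed_closure.isOpen_compl isOpen_compl_singleton
    (fun w _ => or_iff_not_imp_right.2 fun h => by
      rw [mem_compl_iff, not_not, mem_singleton_iff] at h
      exact h ▸ hcl)
    ⟨f p, mem_image_of_mem f (mem_insert p C), hcl⟩
    ⟨f c, mem_image_of_mem f (mem_insert_of_mem p hc), hcp⟩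
  · exact hz₂ rfl
  · exact hz₁ (subset_closure (mem_image_of_mem f hz))

/-- Given a Darboux injection from a compact connected Hausdorff space to a space with charts in a
linear order, the complement of a finite subset of the domain has finitely many components. -/
theorem finite_connectedComponentIn_compl {X Y α : Type*} [TopologicalSpace X] [CompactSpace X]
    [PreconnectedSpace X] [T2Space X] [TopologicalSpace Y] [T2Space Y] [LinearOrder α]
    [TopologicalSpace α] [OrderTopology α] [CompactIccSpace α]
    (hY : ∀ y : Y, ∃ e : OpenPartialHomeomorph Y α, y ∈ e.source) {f : X → Y}
    (hinj : Function.Injective f)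
    (hf : ∀ C : Set X, IsPreconnected C → IsPreconnected (f '' C)) {F : Set X} (hF : F.Finite) :
    (connectedComponentIn Fᶜ '' Fᶜ).Finite := by
  rcases F.eq_empty_or_nonempty with rfl | hne
  · refine (finite_singleton univ).subset ?_
    rintro _ ⟨z, -, rfl⟩
    rw [compl_empty, connectedComponentIn_univ, PreconnectedSpace.connectedComponent_eq_univ]
    rfl
  have : Nonempty X := hne.to_type
  choose e he using hY
  choose L hL using fun y => exists_filter_of_isPreconnected_of_mem_closure (e y) (he y)
  have hgerm : ∀ C ∈ connectedComponentIn Fᶜ '' Fᶜ, ∃ q : X × Bool, q.1 ∈ F ∧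
      (L (f q.1) q.2).NeBot ∧ f '' C ∈ L (f q.1) q.2 := by
    rintro _ ⟨z, hz, rfl⟩
    obtain ⟨p, hp, hpF⟩ :=
      closure_connectedComponentIn_compl_inter_nonempty hF.isClosed hne hz
    have hC : IsPreconnected (connectedComponentIn Fᶜ z) := isPreconnected_connectedComponentIn
    obtain ⟨i, hi⟩ := hL (f p) _ (hf _ hC)
      (fun h => connectedComponentIn_subset _ _ (hinj.mem_set_image.1 h) hpF)
      (mem_closure_image_of_isPreconnected hf hC hp)
    exact ⟨(p, i), hpF, hi⟩
  choose! q hqF hqne hq using hgerm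
  refine Finite.of_finite_image (f := q) ((hF.prod (finite_univ (α := Bool))).subset ?_) ?_
  · rintro _ ⟨C, hC, rfl⟩
    exact ⟨hqF C hC, mem_univ _⟩
  · intro C hC C' hC' h
    have := hqne C hC
    obtain ⟨_, ⟨a, ha, rfl⟩, b, hb, hab⟩ :=
      Filter.nonempty_of_mem (inter_mem (hq C hC) (h ▸ hq C' hC'))
    rw [hinj hab] at hb
    obtain ⟨z, -, rfl⟩ := hC
    obtain ⟨w, -, rfl⟩ := hC'
    exact (connectedComponentIn_eq ha).trans (connectedComponentIn_eq hb).symm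

/-- Every Darboux injection `f : X → Y` from a nonempty compact connected metrizable
space `X` to a 1-manifold `Y` (a metrizable space in which every point has an open
neighborhood homeomorphic to an open subset of the half-line `[0, ∞)`) is a
topological embedding. -/
theorem darboux_injection_to_one_manifold_isEmbedding {X Y : Type*}
    [TopologicalSpace X] [CompactSpace X] [ConnectedSpace X]
    [TopologicalSpace.MetrizableSpace X] [Nonempty X]
    [TopologicalSpace Y] [TopologicalSpace.MetrizableSpace Y]
    (hY : ∀ y : Y, ∃ U : Set Y, IsOpen U ∧ y ∈ U ∧
      ∃ V : Set (Set.Ici (0:ℝ)), IsOpen V ∧ Nonempty (U ≃ₜ V))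
    (f : X → Y) (hinj : Function.Injective f)
    (hdarboux : ∀ C : Set X, IsPreconnected C → IsPreconnected (f '' C)) :
    Topology.IsEmbedding f := by
  have hchart : ∀ y : Y, ∃ e : OpenPartialHomeomorph Y (Ici (0 : ℝ)), y ∈ e.source := by
    intro y
    obtain ⟨U, hU, hyU, V, hV, ⟨φ⟩⟩ := hY y
    have : Nonempty U := ⟨⟨y, hyU⟩⟩
    let ψ : OpenPartialHomeomorph U (Ici (0 : ℝ)) :=
      (hV.isOpenEmbedding_subtypeVal.comp φ.isOpenEmbedding).toOpenPartialHomeomorph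
    refine ⟨(hU.isOpenEmbedding_subtypeVal.toOpenPartialHomeomorph).symm.trans ψ, ?_⟩
    simp [ψ, hyU]
  have : CompactIccSpace (Ici (0 : ℝ)) :=
    ⟨fun {_ _} => isClosed_Ici.isClosedEmbedding_subtypeVal.isCompact_preimage isCompact_Icc⟩
  have hcont : Continuous f := by
    refine continuous_iff_continuousAt.2 fun x N hN => ?_
    obtain ⟨e, he⟩ := hchart (f x)
    obtain ⟨J, hJN, hJ, hxJ, hfin⟩ := exists_isOpen_finite_frontier_subset e he hN
    have hF : (f ⁻¹' frontier J).Finite := hfin.preimage hinj.injOn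
    have hxF : x ∈ (f ⁻¹' frontier J)ᶜ := fun h => by
      rw [mem_preimage, hJ.frontier_eq] at h
      exact h.2 hxJ
    have hxC := mem_connectedComponentIn hxF
    have hopen := isOpen_connectedComponentIn_compl_of_finite hF.isClosed
      (finite_connectedComponentIn_compl hchart hinj hdarboux hF) x
    rw [mem_map]
    refine mem_of_superset (hopen.mem_nhds hxC) (image_subset_iff.1 (Subset.trans ?_ hJN))
    refine (hdarboux _ isPreconnected_connectedComponentIn).subset_of_closure_inter_subset hJ
      ⟨f x, mem_image_of_mem f hxC, hxJ⟩ ?_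
    rintro _ ⟨hz, z, hzC, rfl⟩
    by_contra hzJ
    exact connectedComponentIn_subset _ _ hzC (by
      rw [mem_preimage, hJ.frontier_eq]
      exact ⟨hz, hzJ⟩)
  exact (hcont.isClosedEmbedding hinj).isEmbedding
end

section
/- Let X be a connected closed n-manifold of dimension n ≥ 2 and let F ⊆ X be a subset that is a fence in the subspace topology. Then the complement X \ F is connected and nonempty. -/
/-- A subset `F` of a topological space is a *fence* if (with the subspace topology)
it is a compact metrizable space each of whose connected components is homeomorphic
to a closed bounded interval `[a, b] ⊆ ℝ` with `a ≤ b`. -/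
def IsFence {X : Type*} [TopologicalSpace X] (F : Set X) : Prop :=
  IsCompact F ∧ TopologicalSpace.MetrizableSpace F ∧
    ∀ x ∈ F, ∃ a b : ℝ, a ≤ b ∧
      Nonempty ((connectedComponentIn F x) ≃ₜ (Set.Icc a b))

section

open Set Filter Topology

theorem Complex.exists_continuous_exp_eq {f : ℂ → ℂ} (hf : Continuous f) (h0 : ∀ z, f z ≠ 0) :
    ∃ g : ℂ → ℂ, Continuous g ∧ ∀ z, Complex.exp (g z) = f z := by
  obtain ⟨F, ⟨-, hF⟩, -⟩ := Complex.isCoveringMapOn_exp.existsUnique_continuousMap_lifts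
    ⟨f, hf⟩ (a₀ := 0) (Complex.exp_log (h0 0)) (by simpa using h0)
  exact ⟨F, F.continuous, fun z => congrFun hF z⟩

/-- The identity has no continuous square root on a circle centred at the origin. -/
theorem not_sqrt_on_circle {r : ℝ} (hr : 0 < r) {v : ℂ → ℂ}
    (hv : ContinuousOn v (Metric.sphere 0 r)) (hsq : ∀ z ∈ Metric.sphere (0 : ℂ) r, v z ^ 2 = z) :
    False := by
  have hmem : ∀ t : ℝ, (r : ℂ) * Complex.exp (t * Complex.I) ∈ Metric.sphere (0 : ℂ) r := by
    intro t
    simp [Complex.norm_exp_ofReal_mul_I, abs_of_pos hr]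
  set s : ℝ → ℂ := fun t => v (r * Complex.exp (t * Complex.I)) * Complex.exp (-(t / 2 * Complex.I))
    with hs
  have hsc : Continuous s := by
    refine Continuous.mul ?_ (by fun_prop)
    exact hv.comp_continuous (by fun_prop) hmem
  have hs2 : ∀ t, s t ^ 2 = r := by
    intro t
    rw [hs]
    simp only [mul_pow]
    rw [hsq _ (hmem t), ← Complex.exp_nat_mul, mul_assoc, ← Complex.exp_add]
    ring_nf
    simp
  have hne : ∀ t, s t ≠ 0 := fun t h => by
    have := hs2 t
    rw [h] at this
    simp at this
    exact hr.ne (by exact_mod_cast this)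
  have hloc : IsPreconnected (univ : Set ℝ) := isPreconnected_univ
  have := hloc.eq_of_sq_eq (f := s) (g := fun _ => s 0) hsc.continuousOn continuousOn_const
    (fun t _ => by simp [hs2]) (fun _ => hne 0) (mem_univ 0) rfl
  have h2 := this (mem_univ (2 * Real.pi))
  simp only [hs] at h2
  push_cast at h2
  rw [Complex.exp_two_pi_mul_I,
    show -(2 * (Real.pi : ℂ) / 2 * Complex.I) = -(Real.pi * Complex.I) by ring,
    Complex.exp_neg, Complex.exp_pi_mul_I] at h2
  have h0 := hne 0
  simp [hs] at h2 h0
  exact h0 (by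
    have : v r + v r = 0 := by linear_combination -h2
    linear_combination this / 2)

/-- A continuous nonvanishing function on the punctured plane is a power of the coordinate up to
an exponential factor. -/
theorem exists_zpow_mul_exp {f : ℂ → ℂ} (hf : ContinuousOn f {0}ᶜ) (h0 : ∀ z ≠ 0, f z ≠ 0) :
    ∃ (k : ℤ) (θ : ℂ → ℂ), ContinuousOn θ {0}ᶜ ∧ ∀ z ≠ 0, f z = z ^ k * Complex.exp (θ z) := by
  obtain ⟨g, hg, hgf⟩ := Complex.exists_continuous_exp_eq (f := fun ζ => f (Complex.exp ζ))
    (hf.comp_continuous Complex.continuous_exp (fun ζ => Complex.exp_ne_zero ζ))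
    (fun ζ => h0 _ (Complex.exp_ne_zero ζ))
  have hper : ∀ ζ, ∃ n : ℤ,
      g (ζ + 2 * Real.pi * Complex.I) - g ζ = n * (2 * Real.pi * Complex.I) := by
    intro ζ
    have : Complex.exp (g (ζ + 2 * Real.pi * Complex.I)) = Complex.exp (g ζ) := by
      rw [hgf, hgf, Complex.exp_periodic ζ]
    obtain ⟨n, hn⟩ := Complex.exp_eq_exp_iff_exists_int.1 this
    exact ⟨n, by rw [hn]; ring⟩
  obtain ⟨k, hk⟩ : ∃ k : ℤ, ∀ ζ,
      g (ζ + 2 * Real.pi * Complex.I) - g ζ = k * (2 * Real.pi * Complex.I) := by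
    choose n hn using hper
    have hpi : (2 * Real.pi * Complex.I : ℂ) ≠ 0 := Complex.two_pi_I_ne_zero
    have hc : Continuous fun ζ => (n ζ : ℂ) := by
      have : (fun ζ => (n ζ : ℂ)) = fun ζ =>
          (g (ζ + 2 * Real.pi * Complex.I) - g ζ) / (2 * Real.pi * Complex.I) := by
        ext ζ; rw [hn]; field_simp
      rw [this]; fun_prop
    have hc' : Continuous n :=
      Int.isClosedEmbedding_coe_real.isEmbedding.continuous_iff.2 (by
        have := Complex.continuous_re.comp hc
        simpa [Function.comp_def] using this)
    refine ⟨n 0, fun ζ => ?_⟩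
    rw [hn, PreconnectedSpace.constant inferInstance hc' (x := ζ) (y := 0)]
  set T : ℂ → ℂ := fun ζ => g ζ - k * ζ with hT
  have hTc : Continuous T := by fun_prop
  have hTp : ∀ ζ, T (ζ + 2 * Real.pi * Complex.I) = T ζ := fun ζ => by
    simp only [hT]; linear_combination hk ζ
  have hTint : Function.Periodic T (2 * Real.pi * Complex.I) := hTp
  have hTe : ∀ ζ ζ', Complex.exp ζ = Complex.exp ζ' → T ζ = T ζ' := by
    intro ζ ζ' h
    obtain ⟨n, hn⟩ := Complex.exp_eq_exp_iff_exists_int.1 h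
    rw [hn]
    exact (hTint.int_mul n) ζ'
  refine ⟨k, fun z => T (Complex.log z), ?_, fun z hz => ?_⟩
  · rw [IsOpen.continuousOn_iff isOpen_compl_singleton]
    intro z hz
    by_cases hs : z ∈ Complex.slitPlane
    · exact hTc.continuousAt.comp (continuousAt_clog hs)
    · have hs' : -z ∈ Complex.slitPlane := by
        rw [Complex.mem_slitPlane_iff] at hs ⊢
        push Not at hs
        left
        rcases hs.1.lt_or_eq with h | h
        · simpa using h
        · exact absurd (Complex.ext h hs.2) hz
      have h1 : ContinuousAt (fun y => T (Complex.log (-y) + Real.pi * Complex.I)) z := by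
        refine hTc.continuousAt.comp ?_
        exact (ContinuousAt.clog (by fun_prop) hs').add continuousAt_const
      refine h1.congr ?_
      filter_upwards [isOpen_compl_singleton.mem_nhds hz] with y hy
      refine hTe _ _ ?_
      rw [Complex.exp_add, Complex.exp_log (neg_ne_zero.2 hy), Complex.exp_pi_mul_I,
        Complex.exp_log hy]
      ring
  · have := hgf (Complex.log z)
    simp only [Complex.exp_log hz] at this
    rw [← this, ← Complex.exp_log hz, ← Complex.exp_int_mul, Complex.exp_log hz, ← Complex.exp_add]
    simp [hT]

/-- `w` has a continuous square root on some punctured neighbourhood of `x`. -/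
def HasLocalSqrt {X : Type*} [TopologicalSpace X] (w : X → ℂ) (x : X) : Prop :=
  ∃ v : X → ℂ, ∀ᶠ y in 𝓝[≠] x, ContinuousAt v y ∧ v y ^ 2 = w y

section HasLocalSqrt

variable {X Y : Type*} [TopologicalSpace X] [TopologicalSpace Y] {w w₁ w₂ : X → ℂ} {x : X}

theorem HasLocalSqrt.congr (h : HasLocalSqrt w₁ x) (he : ∀ᶠ y in 𝓝[≠] x, w₁ y = w₂ y) :
    HasLocalSqrt w₂ x := by
  obtain ⟨v, hv⟩ := h
  refine ⟨v, ?_⟩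
  filter_upwards [hv, he] with y h1 h2
  exact ⟨h1.1, h1.2.trans h2⟩

theorem HasLocalSqrt.mul (h₁ : HasLocalSqrt w₁ x) (h₂ : HasLocalSqrt w₂ x) :
    HasLocalSqrt (fun y => w₁ y * w₂ y) x := by
  obtain ⟨v₁, hv₁⟩ := h₁
  obtain ⟨v₂, hv₂⟩ := h₂
  refine ⟨fun y => v₁ y * v₂ y, ?_⟩
  filter_upwards [hv₁, hv₂] with y h1 h2
  exact ⟨h1.1.mul h2.1, by rw [mul_pow, h1.2, h2.2]⟩

theorem HasLocalSqrt.star (h : HasLocalSqrt w x) :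
    HasLocalSqrt (fun y => starRingEnd ℂ (w y)) x := by
  obtain ⟨v, hv⟩ := h
  refine ⟨fun y => starRingEnd ℂ (v y), ?_⟩
  filter_upwards [hv] with y h
  exact ⟨Complex.continuous_conj.continuousAt.comp h.1, by rw [← map_pow, h.2]⟩

theorem hasLocalSqrt_star_iff :
    HasLocalSqrt (fun y => starRingEnd ℂ (w y)) x ↔ HasLocalSqrt w x :=
  ⟨fun h => by simpa using h.star, fun h => h.star⟩

theorem hasLocalSqrt_of_nonneg (hw : Continuous w) (h : ∀ᶠ y in 𝓝[≠] x, w y = ‖w y‖) :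
    HasLocalSqrt w x := by
  refine ⟨fun y => (Real.sqrt ‖w y‖ : ℂ), ?_⟩
  filter_upwards [h] with y hy
  refine ⟨Continuous.continuousAt (by fun_prop), ?_⟩
  rw [← Complex.ofReal_pow, Real.sq_sqrt (norm_nonneg _), ← hy]

theorem hasLocalSqrt_of_ne_zero (hw : ∀ᶠ y in 𝓝 x, ContinuousAt w y) (h : w x ≠ 0) :
    HasLocalSqrt w x := by
  have hx : Complex.exp (Complex.log (w x) / 2) ^ 2 = w x := by
    rw [← Complex.exp_nat_mul]
    push_cast
    rw [mul_div_cancel₀ _ two_ne_zero, Complex.exp_log h]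
  refine ⟨fun y => Complex.exp (Complex.log (w x) / 2) * Complex.exp (Complex.log (w y / w x) / 2),
    eventually_nhdsWithin_of_eventually_nhds ?_⟩
  have h1 : ContinuousAt (fun y => w y / w x) x := hw.self_of_nhds.div_const _
  have h2 : ∀ᶠ y in 𝓝 x, w y / w x ∈ Complex.slitPlane :=
    h1.eventually_mem (Complex.isOpen_slitPlane.mem_nhds (by simp [div_self h]))
  filter_upwards [h2, hw] with y hy hc
  constructor
  · exact continuousAt_const.mul
      (Complex.continuous_exp.continuousAt.comp (((hc.div_const _).clog hy).div_const _))
  · rw [mul_pow, hx, ← Complex.exp_nat_mul]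
    push_cast
    rw [mul_div_cancel₀ _ two_ne_zero, Complex.exp_log (Complex.slitPlane_ne_zero hy)]
    field_simp

theorem hasLocalSqrt_exp {θ : X → ℂ} (h : ∀ᶠ y in 𝓝[≠] x, ContinuousAt θ y) :
    HasLocalSqrt (fun y => Complex.exp (θ y)) x := by
  refine ⟨fun y => Complex.exp (θ y / 2), ?_⟩
  filter_upwards [h] with y hy
  refine ⟨Complex.continuous_exp.continuousAt.comp (hy.div_const _), ?_⟩
  rw [← Complex.exp_nat_mul]
  push_cast
  rw [mul_div_cancel₀ _ two_ne_zero]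

theorem Topology.IsOpenEmbedding.eventually_punctured_iff {ι : Y → X} (hι : IsOpenEmbedding ι)
    (y : Y) {p : X → Prop} : (∀ᶠ x in 𝓝[≠] (ι y), p x) ↔ ∀ᶠ z in 𝓝[≠] y, p (ι z) := by
  rw [eventually_nhdsWithin_iff, eventually_nhdsWithin_iff, ← hι.map_nhds_eq, eventually_map]
  simp [hι.injective.eq_iff]

theorem hasLocalSqrt_comp_iff {ι : Y → X} (hι : IsOpenEmbedding ι) (y : Y) :
    HasLocalSqrt (fun z => w (ι z)) y ↔ HasLocalSqrt w (ι y) := by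
  have : Nonempty Y := ⟨y⟩
  constructor
  · rintro ⟨v, hv⟩
    refine ⟨fun x => v (Function.invFun ι x), ?_⟩
    rw [hι.eventually_punctured_iff]
    filter_upwards [hv] with z hz
    rw [← hι.continuousAt_iff]
    simpa [Function.comp_def, Function.leftInverse_invFun hι.injective _] using hz
  · rintro ⟨v, hv⟩
    refine ⟨fun z => v (ι z), ?_⟩
    rw [hι.eventually_punctured_iff] at hv
    filter_upwards [hv] with z hz
    exact ⟨hz.1.comp hι.continuous.continuousAt, hz.2⟩

end HasLocalSqrt

theorem exists_local_zpow_mul_exp {w : ℂ → ℂ} {a : ℂ}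
    (hw : ∀ᶠ z in 𝓝[≠] a, ContinuousAt w z ∧ w z ≠ 0) :
    ∃ (k : ℤ) (θ : ℂ → ℂ), ∀ᶠ z in 𝓝[≠] a,
      ContinuousAt θ z ∧ w z = (z - a) ^ k * Complex.exp (θ z) := by
  rw [eventually_nhdsWithin_iff, Metric.eventually_nhds_iff] at hw
  obtain ⟨r, hr, hw⟩ := hw
  have hpos : ∀ z : ℂ, (1 + ‖z‖ : ℂ) ≠ 0 := fun z => by
    have : (0 : ℝ) < 1 + ‖z‖ := by positivity
    exact_mod_cast this.ne'
  have hnorm : ∀ z : ℂ, ‖(1 + ‖z‖ : ℂ)‖ = 1 + ‖z‖ := fun z => by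
    rw [← Complex.ofReal_one, ← Complex.ofReal_add, Complex.norm_real, Real.norm_of_nonneg]
    positivity
  set φ : ℂ → ℂ := fun z => a + r * z / (1 + ‖z‖) with hφ
  have hφc : Continuous φ := by
    refine continuous_const.add (Continuous.div (by fun_prop) (by fun_prop) hpos)
  have hφr : ∀ z, z ≠ 0 → dist (φ z) a < r ∧ φ z ≠ a := by
    intro z hz
    constructor
    · rw [dist_eq_norm, hφ]
      simp only [add_sub_cancel_left, norm_div, norm_mul, hnorm, Complex.norm_real,
        Real.norm_of_nonneg hr.le]
      rw [div_lt_iff₀ (by positivity)]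
      nlinarith [norm_nonneg z]
    · simp [hφ, hz, hr.ne', hpos]
  obtain ⟨k, T, hT, hwT⟩ := exists_zpow_mul_exp (f := fun z => w (φ z))
    (fun z hz => ((hw (hφr z hz).1 (hφr z hz).2).1.comp hφc.continuousAt).continuousWithinAt)
    (fun z hz => (hw (hφr z hz).1 (hφr z hz).2).2)
  refine ⟨k, fun z => T ((z - a) / (r - ‖z - a‖)) - k * Real.log (r - ‖z - a‖), ?_⟩
  rw [eventually_nhdsWithin_iff]
  filter_upwards [Metric.ball_mem_nhds a hr] with z hz hza
  rw [Metric.mem_ball, dist_eq_norm] at hz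
  have hza' : z - a ≠ 0 := sub_ne_zero.2 hza
  have hd : (0 : ℝ) < r - ‖z - a‖ := by linarith
  have hd' : (r - ‖z - a‖ : ℂ) ≠ 0 := by exact_mod_cast hd.ne'
  have hζ : (z - a) / (r - ‖z - a‖ : ℂ) ≠ 0 := div_ne_zero hza' hd'
  constructor
  · refine ContinuousAt.sub ?_ ?_
    · refine ContinuousAt.comp (f := fun z => (z - a) / (r - ‖z - a‖ : ℂ)) (g := T)
        ((isOpen_compl_singleton.continuousOn_iff).1 hT hζ) ?_
      exact ContinuousAt.div (by fun_prop) (by fun_prop) hd'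
    · refine continuousAt_const.mul (Complex.continuous_ofReal.continuousAt.comp ?_)
      exact ContinuousAt.log (by fun_prop) hd.ne'
  · have h1 := hwT _ hζ
    have h2 : φ ((z - a) / (r - ‖z - a‖ : ℂ)) = z := by
      have h3 : ‖(z - a) / (r - ‖z - a‖ : ℂ)‖ = ‖z - a‖ / (r - ‖z - a‖) := by
        rw [norm_div, ← Complex.ofReal_sub, Complex.norm_real, Real.norm_of_nonneg hd.le]
      simp only [hφ, h3]
      push_cast
      have hr' : (r : ℂ) ≠ 0 := by exact_mod_cast hr.ne'
      have : (1 + ‖z - a‖ / (r - ‖z - a‖) : ℂ) = r / (r - ‖z - a‖) := by field_simp; ring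
      rw [this]
      field_simp
      ring
    simp only [h2] at h1
    rw [h1, div_zpow, Complex.exp_sub, Complex.exp_int_mul, ← Complex.ofReal_exp,
      Real.exp_log hd]
    push_cast
    ring

theorem not_hasLocalSqrt_sub (a : ℂ) : ¬ HasLocalSqrt (fun z => z - a) a := by
  rintro ⟨v, hv⟩
  rw [eventually_nhdsWithin_iff, Metric.eventually_nhds_iff] at hv
  obtain ⟨r, hr, hv⟩ := hv
  have key : ∀ z ∈ Metric.sphere (0 : ℂ) (r / 2), ContinuousAt v (z + a) ∧ v (z + a) ^ 2 = z := by
    intro z hz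
    have hz' : ‖z‖ = r / 2 := by simpa using hz
    have := @hv (z + a) (by rw [dist_eq_norm, add_sub_cancel_right]; linarith) (by
      have : z ≠ 0 := by rw [← norm_pos_iff]; linarith
      simpa using this)
    simpa using this
  refine not_sqrt_on_circle (half_pos hr) (v := fun z => v (z + a)) (fun z hz => ?_)
    (fun z hz => (key z hz).2)
  exact (ContinuousAt.comp (f := fun z => z + a) (g := v) (key z hz).1
    (by fun_prop)).continuousWithinAt

theorem eventually_punctured_continuousAt_zpow (a : ℂ) (k : ℤ) :
    ∀ᶠ z in 𝓝[≠] a, ContinuousAt (fun z => (z - a) ^ k) z := by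
  rw [eventually_nhdsWithin_iff]
  refine Eventually.of_forall fun z hz => ?_
  exact ContinuousAt.zpow₀ (by fun_prop) _ (Or.inl (sub_ne_zero.2 hz))

theorem hasLocalSqrt_iff_even {w θ : ℂ → ℂ} {a : ℂ} {k : ℤ}
    (h : ∀ᶠ z in 𝓝[≠] a, ContinuousAt θ z ∧ w z = (z - a) ^ k * Complex.exp (θ z)) :
    HasLocalSqrt w a ↔ Even k := by
  have hsq : ∀ m : ℤ, HasLocalSqrt (fun z => (z - a) ^ (m + m)) a := fun m => by
    refine ⟨fun z => (z - a) ^ m, ?_⟩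
    filter_upwards [eventually_punctured_continuousAt_zpow a m, self_mem_nhdsWithin] with z hz hza
    exact ⟨hz, by rw [zpow_add₀ (sub_ne_zero.2 hza), sq]⟩
  constructor
  · intro hw
    by_contra hk
    rw [Int.not_even_iff_odd] at hk
    obtain ⟨m, rfl⟩ := hk
    refine not_hasLocalSqrt_sub a ?_
    have h1 := (hw.mul (hasLocalSqrt_exp (θ := fun z => -θ z) (x := a)
      (by filter_upwards [h] with z hz using hz.1.neg))).mul (hsq (-m))
    refine h1.congr ?_
    filter_upwards [h, self_mem_nhdsWithin] with z hz hza
    have hza' : z - a ≠ 0 := sub_ne_zero.2 hza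
    rw [hz.2, mul_assoc ((z - a) ^ (2 * m + 1)), ← Complex.exp_add, add_neg_cancel,
      Complex.exp_zero, mul_one, ← zpow_add₀ hza']
    ring_nf
    simp
  · rintro ⟨m, rfl⟩
    refine ((hsq m).mul (hasLocalSqrt_exp (θ := θ) (x := a)
      (by filter_upwards [h] with z hz using hz.1))).congr ?_
    filter_upwards [h] with z hz using hz.2.symm

/-- The class of local square-rootability is additive for products of functions on a surface. -/
theorem hasLocalSqrt_mul_iff {X : Type*} [TopologicalSpace X] {ι : ℂ → X} (hι : IsOpenEmbedding ι)
    {x : X} (hx : x ∈ range ι) {w₁ w₂ : X → ℂ}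
    (h₁ : ∀ᶠ y in 𝓝[≠] x, ContinuousAt w₁ y ∧ w₁ y ≠ 0)
    (h₂ : ∀ᶠ y in 𝓝[≠] x, ContinuousAt w₂ y ∧ w₂ y ≠ 0) :
    HasLocalSqrt (fun y => w₁ y * w₂ y) x ↔ (HasLocalSqrt w₁ x ↔ HasLocalSqrt w₂ x) := by
  obtain ⟨a, rfl⟩ := hx
  rw [← hasLocalSqrt_comp_iff hι, ← hasLocalSqrt_comp_iff hι, ← hasLocalSqrt_comp_iff hι]
  rw [hι.eventually_punctured_iff] at h₁ h₂
  obtain ⟨k₁, θ₁, h₁⟩ := exists_local_zpow_mul_exp (w := fun z => w₁ (ι z)) (a := a) (by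
    filter_upwards [h₁] with z hz
    exact ⟨hz.1.comp hι.continuous.continuousAt, hz.2⟩)
  obtain ⟨k₂, θ₂, h₂⟩ := exists_local_zpow_mul_exp (w := fun z => w₂ (ι z)) (a := a) (by
    filter_upwards [h₂] with z hz
    exact ⟨hz.1.comp hι.continuous.continuousAt, hz.2⟩)
  rw [hasLocalSqrt_iff_even h₁, hasLocalSqrt_iff_even h₂, ← Int.even_add]
  refine hasLocalSqrt_iff_even (θ := fun z => θ₁ z + θ₂ z) ?_
  filter_upwards [h₁, h₂, self_mem_nhdsWithin] with z hz₁ hz₂ hza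
  refine ⟨hz₁.1.add hz₂.1, ?_⟩
  rw [hz₁.2, hz₂.2, zpow_add₀ (sub_ne_zero.2 hza), Complex.exp_add]
  ring

theorem hasLocalSqrt_sub_zpow {a b : ℂ} (h : b ≠ a) (k : ℤ) :
    HasLocalSqrt (fun z => (z - a) ^ k) b := by
  refine hasLocalSqrt_of_ne_zero ?_ (zpow_ne_zero _ (sub_ne_zero.2 h))
  filter_upwards [isOpen_compl_singleton.mem_nhds h] with z hz
  exact ContinuousAt.zpow₀ (by fun_prop) _ (Or.inl (sub_ne_zero.2 hz))

/-- A zero of a planar map can be traded for a power of the coordinate. -/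
theorem exists_remove_zero {w : ℂ → ℂ} (hw : Continuous w) (hfin : {z | w z = 0}.Finite)
    {a : ℂ} (ha : w a = 0) :
    ∃ (k : ℤ) (r : ℝ) (w' : ℂ → ℂ), Continuous w' ∧ {z | w' z = 0} = {z | w z = 0} \ {a} ∧
      (HasLocalSqrt w a ↔ Even k) ∧ (∀ b ≠ a, HasLocalSqrt w' b ↔ HasLocalSqrt w b) ∧
      ∀ z, r ≤ ‖z - a‖ → z ≠ a ∧ w' z = w z * (z - a) ^ (-k) := by
  have hiso : ∀ᶠ z in 𝓝[≠] a, ContinuousAt w z ∧ w z ≠ 0 := by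
    have h1 : ∀ᶠ z in 𝓝 a, z ∉ ({z | w z = 0} \ {a}) :=
      (hfin.subset sdiff_subset).isClosed.isOpen_compl.mem_nhds (by simp)
    rw [eventually_nhdsWithin_iff]
    filter_upwards [h1] with z hz hza
    exact ⟨hw.continuousAt, fun h => hz ⟨h, hza⟩⟩
  obtain ⟨k, θ, hθ⟩ := exists_local_zpow_mul_exp hiso
  have heven := hasLocalSqrt_iff_even hθ
  rw [eventually_nhdsWithin_iff, Metric.eventually_nhds_iff] at hθ
  obtain ⟨r, hr, hθ⟩ := hθ
  set χ : ℂ → ℝ := fun z => min 1 (max 0 (3 * ‖z - a‖ / r - 1)) with hχ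
  have hχc : Continuous χ := by fun_prop
  have hχ0 : ∀ z, ‖z - a‖ < r / 3 → χ z = 0 := fun z hz => by
    have : 3 * ‖z - a‖ / r - 1 ≤ 0 := by
      rw [sub_nonpos, div_le_one hr]; linarith
    simp [hχ, max_eq_left this]
  have hχ1 : ∀ z, 2 * r / 3 < ‖z - a‖ → χ z = 1 := fun z hz => by
    have : 1 ≤ 3 * ‖z - a‖ / r - 1 := by
      rw [le_sub_iff_add_le, le_div_iff₀ hr]; linarith
    simp only [hχ]
    rw [min_eq_left (this.trans (le_max_right _ _))]
  classical
  set w' : ℂ → ℂ := fun z => if ‖z - a‖ < r then Complex.exp (χ z * θ z) else w z * (z - a) ^ (-k)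
    with hw'
  have hout : ∀ z, 2 * r / 3 < ‖z - a‖ → w' z = w z * (z - a) ^ (-k) := by
    intro z hz
    by_cases h : ‖z - a‖ < r
    · have hza : z ≠ a := by
        rintro rfl; simp at hz; linarith
      simp only [hw', if_pos h, hχ1 z hz]
      rw [(hθ (by rwa [dist_eq_norm]) hza).2, zpow_neg]
      have := zpow_ne_zero k (sub_ne_zero.2 hza)
      field_simp
      simp
    · simp only [hw', if_neg h]
  have hopen1 : IsOpen {z : ℂ | ‖z - a‖ < r / 3} := isOpen_lt (by fun_prop) continuous_const
  have hopen2 : IsOpen {z : ℂ | ‖z - a‖ < r} := isOpen_lt (by fun_prop) continuous_const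
  have hopen3 : IsOpen {z : ℂ | 2 * r / 3 < ‖z - a‖} := isOpen_lt continuous_const (by fun_prop)
  have hne3 : ∀ z, 2 * r / 3 < ‖z - a‖ → z ≠ a := by
    rintro z hz rfl; simp at hz; linarith
  have hw'c : Continuous w' := by
    rw [continuous_iff_continuousAt]
    intro z
    by_cases h3 : 2 * r / 3 < ‖z - a‖
    · have : ContinuousAt (fun z => w z * (z - a) ^ (-k)) z :=
        hw.continuousAt.mul
          (ContinuousAt.zpow₀ (by fun_prop) _ (Or.inl (sub_ne_zero.2 (hne3 z h3))))
      refine this.congr ?_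
      filter_upwards [hopen3.mem_nhds h3] with y hy using (hout y hy).symm
    · by_cases hza : z = a
      · refine (continuousAt_const (y := (1 : ℂ))).congr ?_
        filter_upwards [hopen1.mem_nhds (show ‖z - a‖ < r / 3 by subst hza; simpa using hr)]
          with y (hy : ‖y - a‖ < r / 3)
        simp [hw', hχ0 y hy, show ‖y - a‖ < r by linarith]
      · have hzr : ‖z - a‖ < r := by linarith
        have : ContinuousAt (fun z => Complex.exp (χ z * θ z)) z :=
          Complex.continuous_exp.continuousAt.comp
            ((Complex.continuous_ofReal.comp hχc).continuousAt.mul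
              (hθ (by rwa [dist_eq_norm]) hza).1)
        refine this.congr ?_
        filter_upwards [hopen2.mem_nhds hzr] with y (hy : ‖y - a‖ < r)
        simp [hw', hy]
  have hin : ∀ z, ‖z - a‖ < r → w' z ≠ 0 := fun z hz => by
    simp only [hw', if_pos hz]; exact Complex.exp_ne_zero _
  have hin' : ∀ z, ‖z - a‖ < r → z ≠ a → w z ≠ 0 := fun z hz hza => by
    rw [(hθ (by rwa [dist_eq_norm]) hza).2]
    exact mul_ne_zero (zpow_ne_zero _ (sub_ne_zero.2 hza)) (Complex.exp_ne_zero _)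
  refine ⟨k, r, w', hw'c, ?_, heven, ?_, ?_⟩
  · ext z
    by_cases hz : ‖z - a‖ < r
    · simp only [mem_ofPred_eq, Set.mem_sdiff, mem_singleton_iff, hin z hz, false_iff]
      exact fun h => hin' z hz h.2 h.1
    · have h3 : 2 * r / 3 < ‖z - a‖ := by linarith
      simp only [mem_ofPred_eq, Set.mem_sdiff, mem_singleton_iff, hout z h3, mul_eq_zero, hne3 z h3,
        zpow_ne_zero _ (sub_ne_zero.2 (hne3 z h3)), or_false, not_false_iff, and_true]
  · intro b hb
    by_cases hz : ‖b - a‖ < r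
    · exact iff_of_true
        (hasLocalSqrt_of_ne_zero (Eventually.of_forall fun _ => hw'c.continuousAt) (hin b hz))
        (hasLocalSqrt_of_ne_zero (Eventually.of_forall fun _ => hw.continuousAt) (hin' b hz hb))
    · have h3 : 2 * r / 3 < ‖b - a‖ := by linarith
      have hev : ∀ᶠ z in 𝓝[≠] b, w' z = w z * (z - a) ^ (-k) ∧ z ≠ a :=
        eventually_nhdsWithin_of_eventually_nhds (by
          filter_upwards [hopen3.mem_nhds h3] with y hy using ⟨hout y hy, hne3 y hy⟩)
      constructor
      · intro h
        refine (h.mul (hasLocalSqrt_sub_zpow hb k)).congr ?_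
        filter_upwards [hev] with z hz
        have := zpow_ne_zero k (sub_ne_zero.2 hz.2)
        rw [hz.1, zpow_neg]
        field_simp
      · intro h
        refine (h.mul (hasLocalSqrt_sub_zpow hb (-k))).congr ?_
        filter_upwards [hev] with z hz using hz.1.symm
  · intro z hz
    exact ⟨hne3 z (by linarith), hout z (by linarith)⟩

theorem even_ncard_of_zpow_mul_exp (n : ℕ) : ∀ (w : ℂ → ℂ), Continuous w →
    {z | w z = 0}.Finite → {z | w z = 0}.ncard = n → ∀ (N : ℤ) (R : ℝ) (θ : ℂ → ℂ), 0 < R →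
    ContinuousOn θ {z | R ≤ ‖z‖} → (∀ z, R ≤ ‖z‖ → w z = z ^ N * Complex.exp (θ z)) →
    (Even N ↔ Even {a | ¬ HasLocalSqrt w a}.ncard) := by
  induction n with
  | zero =>
    intro w hw hfin hcard N R θ hR hθ hwθ
    have h0 : ∀ z, w z ≠ 0 := by
      rw [Set.ncard_eq_zero hfin] at hcard
      intro z hz
      exact (hcard ▸ (show z ∈ {z | w z = 0} from hz) : z ∈ (∅ : Set ℂ))
    have hempty : {a | ¬ HasLocalSqrt w a} = ∅ := by
      ext a
      simpa using hasLocalSqrt_of_ne_zero (Eventually.of_forall fun _ => hw.continuousAt) (h0 a)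
    rw [hempty, ncard_empty]
    simp only [Even.zero, iff_true]
    by_contra hN
    rw [Int.not_even_iff_odd] at hN
    obtain ⟨m, rfl⟩ := hN
    obtain ⟨g, hg, hgw⟩ := Complex.exists_continuous_exp_eq hw h0
    have hsub : Metric.sphere (0 : ℂ) R ⊆ {z | R ≤ ‖z‖} := fun z hz => by
      have : ‖z‖ = R := by simpa using hz
      exact this.ge
    have hne : ∀ z ∈ Metric.sphere (0 : ℂ) R, z ≠ 0 := fun z hz => by
      have : ‖z‖ = R := by simpa using hz
      rw [← norm_pos_iff]; linarith
    refine not_sqrt_on_circle hR (v := fun z => Complex.exp ((g z - θ z) / 2) * z ^ (-m)) ?_ ?_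
    · refine ContinuousOn.mul ?_ ?_
      · exact Complex.continuous_exp.comp_continuousOn
          ((hg.continuousOn.sub (hθ.mono hsub)).div_const _)
      · exact ContinuousOn.zpow₀ continuousOn_id _ (fun z hz => Or.inl (hne z hz))
    · intro z hz
      have h1 := hwθ z (hsub hz)
      have hz0 := hne z hz
      rw [← hgw] at h1
      rw [mul_pow, ← Complex.exp_nat_mul, ← zpow_natCast, ← zpow_mul]
      push_cast
      rw [mul_div_cancel₀ _ two_ne_zero, Complex.exp_sub, h1, mul_div_assoc,
        div_self (Complex.exp_ne_zero _), mul_one, ← zpow_add₀ hz0]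
      ring_nf
      simp
  | succ n ih =>
    intro w hw hfin hcard N R θ hR hθ hwθ
    obtain ⟨a, ha⟩ : {z | w z = 0}.Nonempty := by
      rw [← Set.ncard_pos hfin, hcard]; omega
    obtain ⟨k, r, w', hw', hzero, hk, hodd, hout⟩ := exists_remove_zero hw hfin ha
    have hfin' : {z | w' z = 0}.Finite := hzero ▸ hfin.subset sdiff_subset
    have hcard' : {z | w' z = 0}.ncard = n := by
      rw [hzero, Set.ncard_sdiff_singleton_of_mem ha, hcard]; rfl
    set R' := max R (r + ‖a‖ + 1) ⊔ (2 * ‖a‖ + 1) with hR'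
    have hRR' : R ≤ R' := (le_max_left _ _).trans (le_max_left _ _)
    have hrR' : r + ‖a‖ + 1 ≤ R' := (le_max_right _ _).trans (le_max_left _ _)
    have haR' : 2 * ‖a‖ + 1 ≤ R' := le_max_right _ _
    have hz0 : ∀ z : ℂ, R' ≤ ‖z‖ → z ≠ 0 := fun z hz => by
      rw [← norm_pos_iff]; linarith
    have hslit : ∀ z : ℂ, R' ≤ ‖z‖ → 1 - a / z ∈ Complex.slitPlane := fun z hz => by
      have h1 : ‖a / z‖ < 1 := by
        rw [norm_div, div_lt_one (by linarith)]
        linarith [norm_nonneg a]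
      left
      have := (Complex.re_le_norm (a / z)).trans_lt h1
      simp only [Complex.sub_re, Complex.one_re]
      linarith
    have key := ih w' hw' hfin' hcard' (N - k) R' (fun z => θ z - k * Complex.log (1 - a / z))
      (by linarith) ?_ ?_
    · have hfinodd : {a | ¬ HasLocalSqrt w' a}.Finite := by
        refine hfin'.subset fun b hb => ?_
        by_contra h
        exact hb (hasLocalSqrt_of_ne_zero (Eventually.of_forall fun _ => hw'.continuousAt) h)
      have ha' : HasLocalSqrt w' a := by
        refine hasLocalSqrt_of_ne_zero (Eventually.of_forall fun _ => hw'.continuousAt) ?_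
        intro h
        have : a ∈ {z | w' z = 0} := h
        rw [hzero] at this
        exact this.2 rfl
      by_cases hke : Even k
      · have : {a | ¬ HasLocalSqrt w a} = {a | ¬ HasLocalSqrt w' a} := by
          ext b
          by_cases hb : b = a
          · subst hb; simp [ha', hk, hke]
          · simp [hodd b hb]
        rw [this, ← key, Int.even_sub]
        simp [hke]
      · have : {a | ¬ HasLocalSqrt w a} = insert a {a | ¬ HasLocalSqrt w' a} := by
          ext b
          by_cases hb : b = a
          · subst hb; simp [hk, hke]
          · simp [hodd b hb, hb]
        rw [this, Set.ncard_insert_of_notMem (by simpa using ha') hfinodd, Nat.even_add_one, ← key,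
          Int.even_sub]
        simp [hke]
    · refine (hθ.mono fun z hz => hRR'.trans hz).sub (continuousOn_const.mul ?_)
      refine ContinuousOn.clog ?_ (fun z hz => hslit z hz)
      exact continuousOn_const.sub (continuousOn_const.div continuousOn_id fun z hz => hz0 z hz)
    · intro z hz
      have h1 : r ≤ ‖z - a‖ := by
        have := norm_sub_norm_le z a
        linarith
      have hz' := hz0 z hz
      have h2 : z - a = z * (1 - a / z) := by field_simp
      rw [(hout z h1).2, hwθ z (hRR'.trans hz), h2, mul_zpow, zpow_sub₀ hz', Complex.exp_sub,
        Complex.exp_int_mul, Complex.exp_log (Complex.slitPlane_ne_zero (hslit z hz)), zpow_neg,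
        zpow_neg]
      ring

theorem even_ncard_of_eq_one {w : ℂ → ℂ} (hw : Continuous w) (hfin : {z | w z = 0}.Finite)
    {R : ℝ} (hR : 0 < R) (h1 : ∀ z, R ≤ ‖z‖ → w z = 1) :
    Even {a | ¬ HasLocalSqrt w a}.ncard :=
  (even_ncard_of_zpow_mul_exp _ w hw hfin rfl 0 R (fun _ => 0) hR continuousOn_const
    (by simpa using h1)).1 Even.zero

/-- `f` agrees with a Laurent polynomial, up to a power of `z`, on the unit circle. -/
def IsLaurentOnCircle (f : C(Metric.sphere (0 : ℂ) 1, ℂ)) : Prop :=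
  ∃ (N : ℕ) (q : Polynomial ℂ), ∀ z : Metric.sphere (0 : ℂ) 1, (z : ℂ) ^ N * f z = q.eval (z : ℂ)

theorem IsLaurentOnCircle.add {f g : C(Metric.sphere (0 : ℂ) 1, ℂ)} (hf : IsLaurentOnCircle f)
    (hg : IsLaurentOnCircle g) : IsLaurentOnCircle (f + g) := by
  obtain ⟨N, q, hq⟩ := hf
  obtain ⟨M, p, hp⟩ := hg
  refine ⟨N + M, Polynomial.X ^ M * q + Polynomial.X ^ N * p, fun z => ?_⟩
  simp only [ContinuousMap.add_apply, Polynomial.eval_add, Polynomial.eval_mul,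
    Polynomial.eval_pow, Polynomial.eval_X, ← hq, ← hp]
  ring

theorem IsLaurentOnCircle.mul {f g : C(Metric.sphere (0 : ℂ) 1, ℂ)} (hf : IsLaurentOnCircle f)
    (hg : IsLaurentOnCircle g) : IsLaurentOnCircle (f * g) := by
  obtain ⟨N, q, hq⟩ := hf
  obtain ⟨M, p, hp⟩ := hg
  refine ⟨N + M, q * p, fun z => ?_⟩
  simp only [ContinuousMap.mul_apply, Polynomial.eval_mul, ← hq, ← hp]
  ring

theorem isLaurentOnCircle_of_mem {f : C(Metric.sphere (0 : ℂ) 1, ℂ)}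
    (hf : f ∈ (polynomialFunctions (Metric.sphere (0 : ℂ) 1)).starClosure) :
    IsLaurentOnCircle f ∧ IsLaurentOnCircle (star f) := by
  rw [polynomialFunctions.starClosure_eq_adjoin_X] at hf
  induction hf using StarAlgebra.adjoin_induction with
  | mem f hf =>
    rw [mem_singleton_iff] at hf
    subst hf
    refine ⟨⟨0, Polynomial.X, fun z => by simp⟩, ⟨1, 1, fun z => ?_⟩⟩
    have hz : ‖(z : ℂ)‖ = 1 := by simp
    simp [Complex.mul_conj, Complex.normSq_eq_norm_sq, hz]
  | algebraMap r =>
    exact ⟨⟨0, Polynomial.C r, fun z => by simp⟩,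
      ⟨0, Polynomial.C (star r), fun z => by simp⟩⟩
  | add f g _ _ hf hg => exact ⟨hf.1.add hg.1, by rw [star_add]; exact hf.2.add hg.2⟩
  | mul f g _ _ hf hg => exact ⟨hf.1.mul hg.1, by rw [star_mul]; exact hg.2.mul hf.2⟩
  | star f _ hf => exact ⟨hf.2, by rw [star_star]; exact hf.1⟩

theorem exists_approx_on_unitCircle (f : C(Metric.sphere (0 : ℂ) 1, ℂ)) {ε : ℝ} (hε : 0 < ε) :
    ∃ g : C(Metric.sphere (0 : ℂ) 1, ℂ), dist g f < ε ∧
      {z : Metric.sphere (0 : ℂ) 1 | (g z).im = 0}.Finite := by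
  have hmem :
      f ∈ (polynomialFunctions (Metric.sphere (0 : ℂ) 1)).starClosure.topologicalClosure := by
    rw [polynomialFunctions.starClosure_topologicalClosure]; trivial
  obtain ⟨g, hg, hgf⟩ := Metric.mem_closure_iff.1 hmem (ε / 2) (by positivity)
  rw [dist_comm] at hgf
  have hsub : g + -(star g) ∈ (polynomialFunctions (Metric.sphere (0 : ℂ) 1)).starClosure :=
    add_mem hg (neg_mem (star_mem hg))
  obtain ⟨⟨N, q, hq⟩, -⟩ := isLaurentOnCircle_of_mem hsub
  have hz0 : ∀ z : Metric.sphere (0 : ℂ) 1, (z : ℂ) ≠ 0 := fun z => by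
    have hz : ‖(z : ℂ)‖ = 1 := by simp
    rw [← norm_pos_iff, hz]; exact one_pos
  by_cases hq0 : q = 0
  · refine ⟨g + ContinuousMap.const _ ((ε / 4 : ℝ) * Complex.I), ?_, ?_⟩
    · calc dist (g + ContinuousMap.const _ ((ε / 4 : ℝ) * Complex.I)) f
          ≤ dist (g + ContinuousMap.const _ ((ε / 4 : ℝ) * Complex.I)) g + dist g f :=
            dist_triangle _ _ _
        _ ≤ ε / 4 + dist g f := by
            gcongr
            rw [dist_eq_norm, add_sub_cancel_left, ContinuousMap.norm_le _ (by positivity)]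
            intro z
            simp [abs_of_pos hε]
        _ < ε := by linarith
    · convert Set.finite_empty
      ext z
      have h := hq z
      simp only [hq0, Polynomial.eval_zero, mul_eq_zero, ContinuousMap.add_apply,
        ContinuousMap.neg_apply, ContinuousMap.star_apply] at h
      have h := h.resolve_left (pow_ne_zero _ (hz0 z))
      have : (g z).im = 0 := by
        have := congrArg Complex.im h
        simp at this
        exact this
      simp [this, hε.ne']
  · refine ⟨g, by linarith, ?_⟩
    refine Set.Finite.of_finite_image (f := Subtype.val) ?_ Subtype.val_injective.injOn
    refine (q.roots.toFinset.finite_toSet).subset ?_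
    rintro _ ⟨z, hz, rfl⟩
    have hz : (g z).im = 0 := hz
    simp only [Finset.mem_coe, Multiset.mem_toFinset, Polynomial.mem_roots hq0,
      Polynomial.IsRoot.def, ← hq]
    refine mul_eq_zero_of_right _ ?_
    apply Complex.ext <;> simp [hz]

theorem exists_approx_on_circle {w : ℂ → ℂ} (hw : Continuous w) {ρ ε : ℝ} (hρ : 0 < ρ)
    (hε : 0 < ε) : ∃ P : ℂ → ℂ, Continuous P ∧ (∀ z, ‖z‖ = ρ → ‖P z - w z‖ < ε) ∧
      {z | ‖z‖ = ρ ∧ (P z).im = 0}.Finite := by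
  obtain ⟨g, hg, hfin⟩ := exists_approx_on_unitCircle
    ⟨fun z : Metric.sphere (0 : ℂ) 1 => w (ρ * z), by fun_prop⟩ hε
  obtain ⟨G, hG⟩ := ContinuousMap.exists_restrict_eq
    (Metric.isClosed_sphere (x := (0 : ℂ)) (ε := 1)) g
  have hGg : ∀ z : Metric.sphere (0 : ℂ) 1, G z = g z := fun z => DFunLike.congr_fun hG z
  have hρ' : (ρ : ℂ) ≠ 0 := by exact_mod_cast hρ.ne'
  have hsph : ∀ z : ℂ, ‖z‖ = ρ → z / ρ ∈ Metric.sphere (0 : ℂ) 1 := fun z hz => by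
    simp [hz, abs_of_pos hρ, hρ.ne']
  refine ⟨fun z => G (z / ρ), by fun_prop, fun z hz => ?_, ?_⟩
  · have := (ContinuousMap.dist_apply_le_dist ⟨z / ρ, hsph z hz⟩).trans_lt hg
    rw [dist_eq_norm, ← hGg] at this
    simpa [mul_div_cancel₀ _ hρ'] using this
  · refine (hfin.image fun z : Metric.sphere (0 : ℂ) 1 => (ρ : ℂ) * z).subset ?_
    rintro z ⟨hz, hP⟩
    exact ⟨⟨z / ρ, hsph z hz⟩, by simpa [← hGg] using hP, mul_div_cancel₀ _ hρ'⟩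

theorem exists_radius_avoiding {s : Set ℂ} (hs : s.Finite) :
    ∃ ρ : ℝ, 1 < ρ ∧ ρ < 2 ∧ ∀ z, ‖z‖ = ρ → z ∉ s := by
  obtain ⟨ρ, ⟨h1, h2⟩, h⟩ :=
    ((Set.Ioo_infinite (one_lt_two (α := ℝ))).sdiff (hs.image norm)).nonempty
  exact ⟨ρ, h1, h2, fun z hz hzs => h ⟨z, hzs, hz⟩⟩

theorem exists_perturbation {w : ℂ → ℂ} (hw : Continuous w) {ρ : ℝ} (hρ : 1 < ρ)
    (h0 : ∀ z, ‖z‖ = ρ → w z ≠ 0) : ∃ w' : ℂ → ℂ, Continuous w' ∧ (∀ z, w z ≠ 0 → w' z ≠ 0) ∧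
      (∀ z, w z = ‖w z‖ → w' z = w z) ∧ (∀ z, ‖z‖ ≤ 1 → w' z = w z) ∧
      {z | ‖z‖ = ρ ∧ w' z = -‖w' z‖}.Finite := by
  obtain ⟨m, hm, hmw⟩ : ∃ m : ℝ, 0 < m ∧ ∀ z, ‖z‖ = ρ → m ≤ ‖w z‖ := by
    obtain ⟨z, hz, hmin⟩ := (isCompact_sphere (0 : ℂ) ρ).exists_isMinOn
      (NormedSpace.sphere_nonempty.2 (by linarith)) hw.norm.continuousOn
    exact ⟨‖w z‖, norm_pos_iff.2 (h0 z (by simpa using hz)), fun y hy => hmin (by simpa using hy)⟩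
  obtain ⟨P, hP, hPw, hfin⟩ := exists_approx_on_circle hw (show 0 < ρ by linarith)
    (show 0 < m / 4 by positivity)
  let s : ℂ → ℝ := fun z => min 1 (max 0 ((4 / m) * (‖w z‖ / 2 - ‖P z - w z‖)))
  let ν : ℂ → ℝ := fun z => min 1 (max 0 ((‖z‖ - 1) / (ρ - 1)))
  let β : ℂ → ℝ := fun z => min 1 (max 0 ((2 / m) * (‖w z‖ - (w z).re)))
  have hc : ∀ x : ℝ, 0 ≤ min 1 (max 0 x) ∧ min 1 (max 0 x) ≤ 1 := fun x =>
    ⟨le_min zero_le_one (le_max_left _ _), min_le_left _ _⟩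
  let u : ℂ → ℝ := fun z => s z * ν z * β z
  refine ⟨fun z => w z + u z * (P z - w z), by fun_prop, fun z hz hz' => ?_, fun z hz => ?_,
    fun z hz => ?_, ?_⟩
  · by_cases hs : ‖w z‖ / 2 ≤ ‖P z - w z‖
    · have : s z = 0 := by
        have : (4 / m) * (‖w z‖ / 2 - ‖P z - w z‖) ≤ 0 :=
          mul_nonpos_of_nonneg_of_nonpos (by positivity) (by linarith)
        simp [s, max_eq_left this]
      simp only [u, this, zero_mul, Complex.ofReal_zero, add_zero] at hz'
      exact hz hz'
    · push Not at hs
      have hu0 : 0 ≤ u z := mul_nonneg (mul_nonneg (hc _).1 (hc _).1) (hc _).1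
      have hu1 : u z ≤ 1 :=
        mul_le_one₀ (mul_le_one₀ (hc _).2 (hc _).1 (hc _).2) (hc _).1 (hc _).2
      have h1 : ‖w z‖ = u z * ‖P z - w z‖ := by
        have := congrArg norm (eq_neg_of_add_eq_zero_left hz')
        rwa [norm_neg, norm_mul, Complex.norm_real, Real.norm_of_nonneg hu0] at this
      have h2 : 0 < ‖w z‖ := norm_pos_iff.2 hz
      nlinarith [norm_nonneg (P z - w z)]
  · have : β z = 0 := by
      have : (w z).re = ‖w z‖ := by
        have := congrArg Complex.re hz
        simpa using this
      simp [β, this]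
    simp [u, this]
  · have : ν z = 0 := by
      have : (‖z‖ - 1) / (ρ - 1) ≤ 0 := div_nonpos_of_nonpos_of_nonneg (by linarith) (by linarith)
      simp [ν, max_eq_left this]
    simp [u, this]
  · refine hfin.subset ?_
    rintro z ⟨hz, hneg⟩
    refine ⟨hz, ?_⟩
    have hP' := hPw z hz
    have hm' := hmw z hz
    have hs : s z = 1 := by
      refine min_eq_left (le_max_of_le_right ?_)
      rw [div_mul_eq_mul_div, le_div_iff₀ hm]; linarith
    have hν : ν z = 1 := by
      refine min_eq_left (le_max_of_le_right ?_)
      rw [hz, div_self (by linarith)]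
    have hu : u z = β z := by simp [u, hs, hν]
    simp only [hu] at hneg
    have hre : (w z).re ≤ m / 4 := by
      have h1 : (w z).re + β z * (P z - w z).re ≤ 0 := by
        have := congrArg Complex.re hneg
        simp only [Complex.add_re, Complex.re_ofReal_mul, Complex.neg_re, Complex.ofReal_re] at this
        rw [this]; exact neg_nonpos.2 (norm_nonneg _)
      have h2 := (abs_le.1 ((Complex.abs_re_le_norm (P z - w z)).trans hP'.le)).1
      have h3 := (hc ((2 / m) * (‖w z‖ - (w z).re)))
      have h4 : 0 ≤ β z := h3.1
      have h5 : β z ≤ 1 := h3.2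
      nlinarith
    have hβ : β z = 1 := by
      refine min_eq_left (le_max_of_le_right ?_)
      rw [div_mul_eq_mul_div, le_div_iff₀ hm]; linarith
    have := congrArg Complex.im hneg
    simpa [hβ] using this

theorem exists_extension_eq_one {w : ℂ → ℂ} (hw : Continuous w) (hfin : {z | w z = 0}.Finite) :
    ∃ w₁ : ℂ → ℂ, Continuous w₁ ∧ {z | w₁ z = 0}.Finite ∧ (∀ z, ‖z‖ ≤ 1 → w₁ z = w z) ∧
      (∀ z, w z = ‖w z‖ → w₁ z = ‖w₁ z‖) ∧ ∀ z, 3 ≤ ‖z‖ → w₁ z = 1 := by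
  obtain ⟨ρ, hρ1, hρ2, hρ⟩ := exists_radius_avoiding hfin
  obtain ⟨w', hw', hne, hpos, hball, hneg⟩ := exists_perturbation hw hρ1 hρ
  obtain ⟨K, hK1, hK2, hK0⟩ : ∃ K : ℝ, 1 / 2 ≤ K * (ρ - 1) ∧ 1 / 2 ≤ K * (2 - ρ) ∧ 0 < K := by
    refine ⟨max (1 / 2 / (ρ - 1)) (1 / 2 / (2 - ρ)), ?_, ?_, ?_⟩
    · rw [← div_le_iff₀ (by linarith)]; exact le_max_left _ _
    · rw [← div_le_iff₀ (by linarith)]; exact le_max_right _ _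
    · exact lt_max_of_lt_left (by have : 0 < ρ - 1 := by linarith
                                  positivity)
  let τ : ℂ → ℝ := fun z => min 1 (max 0 (1 / 2 + K * (‖z‖ - ρ)))
  let χ : ℂ → ℝ := fun z => min 1 (max 0 (‖z‖ - 2))
  have hc : ∀ x : ℝ, 0 ≤ min 1 (max 0 x) ∧ min 1 (max 0 x) ≤ 1 := fun x =>
    ⟨le_min zero_le_one (le_max_left _ _), min_le_left _ _⟩
  have hτ0 : ∀ z, ‖z‖ ≤ 1 → τ z = 0 := fun z hz => by
    have : 1 / 2 + K * (‖z‖ - ρ) ≤ 0 := by nlinarith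
    simp only [τ]
    rw [max_eq_left this]; simp
  have hτ1 : ∀ z, 2 ≤ ‖z‖ → τ z = 1 := fun z hz => by
    refine min_eq_left (le_max_of_le_right ?_); nlinarith
  have hτ2 : ∀ z, τ z = 1 / 2 → ‖z‖ = ρ := fun z hz => by
    have : 1 / 2 + K * (‖z‖ - ρ) = 1 / 2 := by
      simp only [τ] at hz
      rcases min_choice 1 (max 0 (1 / 2 + K * (‖z‖ - ρ))) with h | h <;> rw [h] at hz
      · norm_num at hz
      · rcases max_choice 0 (1 / 2 + K * (‖z‖ - ρ)) with h | h <;> rw [h] at hz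
        · norm_num at hz
        · exact hz
    have : K * (‖z‖ - ρ) = 0 := by linarith
    have := (mul_eq_zero.1 this).resolve_left hK0.ne'
    linarith
  have hχ0 : ∀ z, ‖z‖ ≤ 2 → χ z = 0 := fun z hz => by
    simp only [χ]
    rw [max_eq_left (by linarith)]; simp
  have hχ1 : ∀ z, 3 ≤ ‖z‖ → χ z = 1 := fun z hz =>
    min_eq_left (le_max_of_le_right (by linarith))
  refine ⟨fun z => (1 - χ z : ℝ) * ((1 - τ z : ℝ) * w' z + (τ z * ‖w' z‖ : ℝ)) + χ z,
    by fun_prop, ?_, fun z hz => ?_, fun z hz => ?_, fun z hz => ?_⟩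
  · refine (hfin.union hneg).subset fun z hz => ?_
    by_contra hcon
    simp only [mem_union, mem_ofPred_eq, not_or, not_and] at hcon hz
    have hw'z := hne z hcon.1
    rcases le_total ‖z‖ 2 with h2 | h2
    · simp only [hχ0 z h2, sub_zero, Complex.ofReal_one, one_mul, Complex.ofReal_zero,
        add_zero] at hz
      have h1 : (1 - τ z) = τ z := by
        have h3 := congrArg norm (eq_neg_of_add_eq_zero_left hz)
        rw [norm_neg, norm_mul, Complex.norm_real, Complex.norm_real, Real.norm_of_nonneg
          (sub_nonneg.2 (hc _).2), Real.norm_of_nonneg (mul_nonneg (hc _).1 (norm_nonneg _))] at h3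
        exact mul_right_cancel₀ (norm_ne_zero_iff.2 hw'z) h3
      have h3 : τ z = 1 / 2 := by linarith
      refine hcon.2 (hτ2 z h3) ?_
      rw [h1, h3] at hz
      push_cast at hz
      linear_combination 2 * hz
    · rw [hτ1 z h2] at hz
      have hz : (1 - χ z) * ‖w' z‖ + χ z = 0 := by
        simp only [sub_self, Complex.ofReal_zero, zero_mul, zero_add, one_mul] at hz
        exact_mod_cast hz
      have h3 : 0 ≤ χ z := (hc _).1
      have h4 : χ z ≤ 1 := (hc _).2
      have h5 : 0 < ‖w' z‖ := norm_pos_iff.2 hw'z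
      have h6 : 0 ≤ (1 - χ z) * ‖w' z‖ := mul_nonneg (by linarith) h5.le
      have h7 : χ z = 0 := by linarith
      rw [h7] at hz
      linarith
  · simp [hτ0 z hz, hχ0 z (by linarith), hball z hz]
  · have h1 := hpos z hz
    rw [hz] at h1
    have h2 : (1 - χ z : ℝ) * ((1 - τ z : ℝ) * w' z + (τ z * ‖w' z‖ : ℝ)) + χ z =
        (((1 - χ z) * ‖w z‖ + χ z : ℝ) : ℂ) := by
      rw [h1, Complex.norm_real, norm_norm]; push_cast; ring
    beta_reduce
    rw [h2, Complex.norm_real, Real.norm_of_nonneg]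
    exact add_nonneg (mul_nonneg (sub_nonneg.2 (hc _).2) (norm_nonneg _)) (hc _).1
  · simp [hχ1 z hz]

theorem Topology.IsOpenEmbedding.continuous_extend_one {X : Type*} [TopologicalSpace X]
    [T2Space X] {ι : ℂ → X} (hι : IsOpenEmbedding ι) {g : ℂ → ℂ} (hg : Continuous g)
    (hlim : Tendsto g (cocompact ℂ) (𝓝 1)) :
    Continuous (Function.extend ι g fun _ => 1) := by
  rw [continuous_iff_continuousAt]
  intro x
  by_cases hx : x ∈ range ι
  · obtain ⟨z, rfl⟩ := hx
    rw [← hι.continuousAt_iff, Function.extend_comp hι.injective]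
    exact hg.continuousAt
  · intro V hV
    rw [Function.extend_apply' _ _ _ (by simpa using hx)] at hV
    obtain ⟨K, hK, hKV⟩ := mem_cocompact.1 (hlim hV)
    rw [mem_map]
    filter_upwards [(hK.image hι.continuous).isClosed.isOpen_compl.mem_nhds
      (show x ∈ (ι '' K)ᶜ from fun ⟨z, _, hz⟩ => hx ⟨z, hz⟩)] with y hy
    show Function.extend ι g (fun _ => 1) y ∈ V
    by_cases hyr : y ∈ range ι
    · obtain ⟨z, rfl⟩ := hyr
      rw [hι.injective.extend_apply]
      exact hKV fun hz => hy ⟨z, hz, rfl⟩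
    · rw [Function.extend_apply' _ _ _ (by simpa using hyr)]
      exact mem_of_mem_nhds hV

theorem even_ncard_of_symmDiff {α : Type*} {s t u : Set α} (hs : s.Finite) (ht : t.Finite)
    (hse : Even s.ncard) (hte : Even t.ncard) (hu : ∀ x, x ∈ u ↔ (x ∈ s ↔ x ∉ t)) :
    Even u.ncard := by
  have h : u = s \ t ∪ t \ s := by
    ext x
    simp only [hu, mem_union, Set.mem_sdiff]
    tauto
  rw [h, ncard_union_eq (disjoint_sdiff_sdiff) hs.sdiff ht.sdiff]
  have h1 := ncard_inter_add_ncard_sdiff_eq_ncard s t hs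
  have h2 := ncard_inter_add_ncard_sdiff_eq_ncard t s ht
  rw [inter_comm] at h2
  grind

theorem eventually_continuousAt_ne_zero {X : Type*} [TopologicalSpace X] [T1Space X] {w : X → ℂ}
    (hw : Continuous w) (hfin : {x | w x = 0}.Finite) (x : X) :
    ∀ᶠ y in 𝓝[≠] x, ContinuousAt w y ∧ w y ≠ 0 := by
  have : ({y | w y = 0} \ {x})ᶜ ∈ 𝓝 x :=
    hfin.sdiff.isClosed.isOpen_compl.mem_nhds (by simp)
  filter_upwards [mem_nhdsWithin_of_mem_nhds this, self_mem_nhdsWithin] with y hy hyx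
  exact ⟨hw.continuousAt, fun h => hy ⟨h, hyx⟩⟩

theorem finite_not_hasLocalSqrt {X : Type*} [TopologicalSpace X] {w : X → ℂ}
    (hw : Continuous w) (hfin : {x | w x = 0}.Finite) : {x | ¬ HasLocalSqrt w x}.Finite := by
  refine hfin.subset fun b hb => ?_
  by_contra h
  exact hb (hasLocalSqrt_of_ne_zero (Eventually.of_forall fun _ => hw.continuousAt) h)

theorem even_ncard_of_charts {X : Type*} [TopologicalSpace X] [T2Space X]
    (hX : ∀ x : X, ∃ ι : ℂ → X, IsOpenEmbedding ι ∧ x ∈ range ι) (l : List (ℂ → X)) :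
    (∀ ι ∈ l, IsOpenEmbedding ι) → ∀ w : X → ℂ, Continuous w → {x | w x = 0}.Finite →
    (∀ x, (∃ ι ∈ l, ∃ z, ‖z‖ ≤ 1 ∧ ι z = x) ∨ w x = ‖w x‖) →
    Even {x | ¬ HasLocalSqrt w x}.ncard := by
  induction l with
  | nil =>
    intro _ w hw _ hcov
    have : {x | ¬ HasLocalSqrt w x} = ∅ := by
      ext x
      simpa using hasLocalSqrt_of_nonneg hw (Eventually.of_forall fun y => by simpa using hcov y)
    simp [this]
  | cons ι l ih =>
    intro hl w hw hfin hcov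
    have hι : IsOpenEmbedding ι := hl ι List.mem_cons_self
    obtain ⟨g, hg, hgfin, hgball, hgpos, hgone⟩ :=
      exists_extension_eq_one (w := fun z => w (ι z)) (hw.comp hι.continuous)
        (hfin.preimage hι.injective.injOn)
    set w₁ : X → ℂ := Function.extend ι g fun _ => 1 with hw₁
    have hw₁ι : ∀ z, w₁ (ι z) = g z := fun z => hι.injective.extend_apply _ _ z
    have hw₁out : ∀ x, x ∉ range ι → w₁ x = 1 := fun x hx =>
      Function.extend_apply' _ _ _ (by simpa using hx)
    have hlim : Tendsto g (cocompact ℂ) (𝓝 1) := by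
      refine tendsto_const_nhds.congr' ?_
      filter_upwards [(isCompact_closedBall (0 : ℂ) 3).compl_mem_cocompact] with z hz
      refine (hgone z ?_).symm
      simp at hz
      exact hz.le
    have hw₁c : Continuous w₁ := hι.continuous_extend_one hg hlim
    have hw₁fin : {x | w₁ x = 0}.Finite := by
      refine (hgfin.image ι).subset fun x hx => ?_
      by_cases hxr : x ∈ range ι
      · obtain ⟨z, rfl⟩ := hxr
        exact ⟨z, by simpa [hw₁ι] using hx, rfl⟩
      · exact absurd ((hw₁out x hxr).symm.trans hx) one_ne_zero
    have hstar : Continuous fun x => star (w₁ x) := hw₁c.star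
    have hstarfin : {x | star (w₁ x) = 0}.Finite := by simpa using hw₁fin
    set W : X → ℂ := fun x => w x * star (w₁ x) with hW
    have hWc : Continuous W := hw.mul hstar
    have hWfin : {x | W x = 0}.Finite := by
      refine (hfin.union hw₁fin).subset fun x hx => ?_
      simpa [hW] using hx
    have hWe : Even {x | ¬ HasLocalSqrt W x}.ncard := by
      refine ih (fun ι' h => hl ι' (List.mem_cons_of_mem _ h)) W hWc hWfin fun x => ?_
      rcases hcov x with ⟨ι', hmem, z, hz, rfl⟩ | hx
      · rcases List.mem_cons.1 hmem with rfl | hmem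
        · right
          simp only [hW, hw₁ι, hgball z hz, RCLike.star_def, Complex.mul_conj,
            Complex.normSq_eq_norm_sq, Complex.norm_real]
          simp
        · exact Or.inl ⟨ι', hmem, z, hz, rfl⟩
      · right
        have : w₁ x = ‖w₁ x‖ := by
          by_cases hxr : x ∈ range ι
          · obtain ⟨z, rfl⟩ := hxr
            rw [hw₁ι]; exact hgpos z hx
          · simp [hw₁out x hxr]
        simp only [hW]
        rw [hx, this]
        simp
    have hoddrange : {x | ¬ HasLocalSqrt w₁ x} = ι '' {z | ¬ HasLocalSqrt g z} := by
      ext x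
      constructor
      · intro hx
        by_cases hxr : x ∈ range ι
        · obtain ⟨z, rfl⟩ := hxr
          refine ⟨z, fun h => hx ?_, rfl⟩
          rw [← hasLocalSqrt_comp_iff hι]
          simpa only [hw₁ι] using h
        · exact absurd (hasLocalSqrt_of_ne_zero (Eventually.of_forall fun _ => hw₁c.continuousAt)
            (by simp [hw₁out x hxr])) hx
      · rintro ⟨z, hz, rfl⟩ h
        rw [← hasLocalSqrt_comp_iff hι] at h
        exact hz (by simpa only [hw₁ι] using h)
    have hw₁e : Even {x | ¬ HasLocalSqrt w₁ x}.ncard := by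
      rw [hoddrange, ncard_image_of_injective _ hι.injective]
      exact even_ncard_of_eq_one hg hgfin three_pos hgone
    refine even_ncard_of_symmDiff (finite_not_hasLocalSqrt hWc hWfin)
      (finite_not_hasLocalSqrt hw₁c hw₁fin) hWe hw₁e fun x => ?_
    obtain ⟨ι', hι', hx⟩ := hX x
    have h := hasLocalSqrt_mul_iff hι' hx (eventually_continuousAt_ne_zero hw hfin x)
      (eventually_continuousAt_ne_zero hstar hstarfin x)
    have h' : HasLocalSqrt (fun x => star (w₁ x)) x ↔ HasLocalSqrt w₁ x := hasLocalSqrt_star_iff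
    rw [h'] at h
    simp only [mem_ofPred_eq, hW]
    tauto

theorem even_ncard_not_hasLocalSqrt {X : Type*} [TopologicalSpace X] [T2Space X] [CompactSpace X]
    (hX : ∀ x : X, ∃ ι : ℂ → X, IsOpenEmbedding ι ∧ x ∈ range ι) {w : X → ℂ} (hw : Continuous w)
    (hfin : {x | w x = 0}.Finite) : Even {x | ¬ HasLocalSqrt w x}.ncard := by
  have hX' : ∀ x : X, ∃ ι : ℂ → X, IsOpenEmbedding ι ∧ ι 0 = x := fun x => by
    obtain ⟨ι, hι, z, rfl⟩ := hX x
    exact ⟨fun y => ι (y + z), hι.comp (Homeomorph.addRight z).isOpenEmbedding, by simp⟩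
  choose ι hι h0 using hX'
  obtain ⟨t, ht⟩ := isCompact_univ.elim_finite_subcover
    (fun x => ι x '' Metric.ball 0 1) (fun x => (hι x).isOpenMap _ Metric.isOpen_ball)
    fun x _ => mem_iUnion.2 ⟨x, 0, by simp, h0 x⟩
  refine even_ncard_of_charts hX (t.toList.map ι) (by simpa using fun x _ => hι x) w hw hfin
    fun x => Or.inl ?_
  obtain ⟨y, hy, z, hz, hzx⟩ := mem_iUnion₂.1 (ht (mem_univ x))
  exact ⟨ι y, by simpa using ⟨y, hy, rfl⟩, z, by simpa using (mem_ball_zero_iff.1 hz).le, hzx⟩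

/-- Every connected component of `K` admits a continuous injection into the real line. -/
def HasLinearComponents (K : Type*) [TopologicalSpace K] : Prop :=
  ∀ x : K, ∃ h : K → ℝ, ContinuousOn h (connectedComponent x) ∧ InjOn h (connectedComponent x)

theorem exists_isClopen_subset {K : Type*} [TopologicalSpace K] [CompactSpace K] [T2Space K]
    (x : K) {U : Set K} (hU : IsOpen U) (hx : connectedComponent x ⊆ U) :
    ∃ V, IsClopen V ∧ x ∈ V ∧ V ⊆ U := by
  have : Nonempty { s : Set K // IsClopen s ∧ x ∈ s } := ⟨⟨univ, isClopen_univ, mem_univ x⟩⟩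
  obtain ⟨V, hV⟩ := exists_subset_nhds_of_compactSpace
    (V := fun s : { s : Set K // IsClopen s ∧ x ∈ s } => (s : Set K)) (U := U)
    (fun s t => ⟨⟨s ∩ t, s.2.1.inter t.2.1, s.2.2, t.2.2⟩, inter_subset_left, inter_subset_right⟩)
    (fun s => s.2.1.isClosed)
    (fun y hy => hU.mem_nhds (hx (by rwa [connectedComponent_eq_iInter_isClopen])))
  exact ⟨V, V.2.1, V.2.2, hV⟩

theorem exists_exp_eq_on_linear {K : Type*} [TopologicalSpace K] [T2Space K]
    {C : Set K} (hC : IsCompact C) (hC' : IsConnected C) {h : K → ℝ} (hh : ContinuousOn h C)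
    (hinj : InjOn h C) {φ : K → ℂ} (hφ : Continuous φ) (h0 : ∀ x, φ x ≠ 0) :
    ∃ g : C → ℂ, Continuous g ∧ ∀ x : C, Complex.exp (g x) = φ x := by
  have : CompactSpace C := isCompact_iff_compactSpace.1 hC
  have : ConnectedSpace C := isConnected_iff_connectedSpace.1 hC'
  let k : C → ℝ := C.domRestrict h
  have hk : Continuous k := hh.domRestrict
  have hkinj : Function.Injective k := hinj.injective
  have hke : IsClosedEmbedding k := hk.isClosedEmbedding hkinj
  have hrange : IsClosed (range k) := hke.isClosed_range
  let e := hke.isEmbedding.toHomeomorph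
  have hIcc := eq_Icc_of_connected_compact (isConnected_range hk) (isCompact_range hk)
  set a := sInf (range k)
  set b := sSup (range k)
  have hab : a ≤ b := by
    have : (Icc a b).Nonempty := hIcc ▸ range_nonempty k
    exact nonempty_Icc.1 this
  let p : ℂ → range k := fun z => ⟨projIcc a b hab z.re, hIcc.ge (projIcc a b hab z.re).2⟩
  have hp : Continuous p := by
    refine Continuous.subtype_mk ?_ _
    exact continuous_subtype_val.comp (continuous_projIcc.comp Complex.continuous_re)
  obtain ⟨L, hL, hLexp⟩ := Complex.exists_continuous_exp_eq
    (f := fun z => φ (e.symm (p z))) (by fun_prop) (fun z => h0 _)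
  refine ⟨fun x => L (k x), by fun_prop, fun x => ?_⟩
  rw [hLexp]
  have : p (k x) = e x := by
    apply Subtype.ext
    have hx : k x ∈ Icc a b := hIcc ▸ mem_range_self x
    simp only [p, Complex.ofReal_re, projIcc_of_mem hab hx]
    rfl
  rw [this, e.symm_apply_apply]

theorem HasLinearComponents.exists_exp_eq {K : Type*} [TopologicalSpace K] [CompactSpace K]
    [T2Space K] (hK : HasLinearComponents K) {φ : K → ℂ} (hφ : Continuous φ)
    (h0 : ∀ x, φ x ≠ 0) : ∃ g : K → ℂ, Continuous g ∧ ∀ x, Complex.exp (g x) = φ x := by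
  suffices h : ∃ V : Set K, IsClopen V ∧ univ ⊆ V ∧
      ∃ g : K → ℂ, Continuous g ∧ ∀ x ∈ V, Complex.exp (g x) = φ x by
    obtain ⟨V, -, hV, g, hg, h⟩ := h
    exact ⟨g, hg, fun x => h x (hV (mem_univ x))⟩
  refine isCompact_univ.induction_on (p := fun s => ∃ V : Set K, IsClopen V ∧ s ⊆ V ∧
    ∃ g : K → ℂ, Continuous g ∧ ∀ x ∈ V, Complex.exp (g x) = φ x) ?_ ?_ ?_ ?_
  · exact ⟨∅, isClopen_empty, subset_rfl, 0, continuous_zero, by simp⟩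
  · rintro s t hst ⟨V, hV, htV, h⟩
    exact ⟨V, hV, hst.trans htV, h⟩
  · rintro s t ⟨V, hV, hsV, g, hg, hgV⟩ ⟨V', hV', htV', g', hg', hgV'⟩
    classical
    refine ⟨V ∪ V', hV.union hV', union_subset_union hsV htV', V.piecewise g g',
      continuous_piecewise (by simp [hV.frontier_eq]) hg.continuousOn hg'.continuousOn, ?_⟩
    intro x hx
    by_cases hxV : x ∈ V
    · rw [piecewise_eq_of_mem _ _ _ hxV, hgV x hxV]
    · rw [piecewise_eq_of_notMem _ _ _ hxV, hgV' x (hx.resolve_left hxV)]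
  · intro x _
    obtain ⟨h, hh, hinj⟩ := hK x
    obtain ⟨g, hg, hgφ⟩ := exists_exp_eq_on_linear
      (isClosed_connectedComponent (x := x)).isCompact isConnected_connectedComponent hh hinj hφ h0
    obtain ⟨G, hG⟩ := ContinuousMap.exists_restrict_eq
      (isClosed_connectedComponent (x := x)) ⟨g, hg⟩
    have hGg : ∀ y : connectedComponent x, G y = g y := fun y => DFunLike.congr_fun hG y
    have hψ : Continuous fun y => φ y * Complex.exp (-G y) := by fun_prop
    obtain ⟨V, hV, hxV, hVU⟩ := exists_isClopen_subset x
      (Complex.isOpen_slitPlane.preimage hψ) (fun y hy => by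
        have h1 := hgφ ⟨y, hy⟩
        rw [← hGg] at h1
        show φ y * Complex.exp (-G y) ∈ Complex.slitPlane
        rw [← h1, ← Complex.exp_add]
        simp)
    classical
    refine ⟨V, mem_nhdsWithin_of_mem_nhds (hV.isOpen.mem_nhds hxV), V, hV, subset_rfl,
      V.piecewise (fun y => G y + Complex.log (φ y * Complex.exp (-G y))) 0,
      continuous_piecewise (by simp [hV.frontier_eq]) ?_ continuousOn_const, fun y hy => ?_⟩
    · rw [hV.isClosed.closure_eq]
      exact G.continuous.continuousOn.add (hψ.continuousOn.clog fun y hy => hVU hy)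
    · rw [piecewise_eq_of_mem _ _ _ hy, Complex.exp_add,
        Complex.exp_log (Complex.slitPlane_ne_zero (hVU hy))]
      rw [mul_left_comm, ← Complex.exp_add, add_neg_cancel, Complex.exp_zero, mul_one]

theorem HasLinearComponents.of_injective {K L : Type*} [TopologicalSpace K] [TopologicalSpace L]
    (hL : HasLinearComponents L) {f : K → L} (hf : Continuous f) (hinj : Function.Injective f) :
    HasLinearComponents K := by
  intro x
  obtain ⟨h, hh, hhinj⟩ := hL (f x)
  have hmaps : MapsTo f (connectedComponent x) (connectedComponent (f x)) :=
    hf.mapsTo_connectedComponent x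
  exact ⟨h ∘ f, hh.comp hf.continuousOn hmaps, hhinj.comp hinj.injOn hmaps⟩

theorem not_injective_of_one_lt_rank {E : Type*} [NormedAddCommGroup E] [NormedSpace ℝ E]
    (hE : 1 < Module.rank ℝ E) {f : E → ℝ} (hf : Continuous f) : ¬ Function.Injective f := by
  intro hinj
  have : Nontrivial E := by
    rw [← rank_pos_iff_nontrivial (R := ℝ)]
    exact zero_lt_one.trans hE
  obtain ⟨x, y, hxy⟩ : ∃ x y : E, f x < f y := by
    obtain ⟨x, y, hne⟩ := exists_pair_ne E
    rcases lt_or_gt_of_ne (hinj.ne hne) with h | h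
    exacts [⟨x, y, h⟩, ⟨y, x, h⟩]
  have hmid : (f x + f y) / 2 ∈ Icc (f x) (f y) := ⟨by linarith, by linarith⟩
  obtain ⟨v, hv⟩ := mem_range_of_exists_le_of_exists_ge hf ⟨x, hmid.1⟩ ⟨y, hmid.2⟩
  have hcon := (isConnected_compl_singleton_of_one_lt_rank hE v).isPreconnected
  have hxv : x ∈ ({v}ᶜ : Set E) := by rintro rfl; linarith
  have hyv : y ∈ ({v}ᶜ : Set E) := by rintro rfl; linarith
  obtain ⟨v', hv', hvv⟩ := hcon.intermediate_value hxv hyv hf.continuousOn hmid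
  exact hv' (hinj (hvv.trans hv.symm))

theorem interior_eq_empty_of_hasLinearComponents {X E : Type*} [TopologicalSpace X]
    [NormedAddCommGroup E] [NormedSpace ℝ E] (hE : 1 < Module.rank ℝ E)
    (hX : ∀ x : X, ∃ ι : E → X, IsOpenEmbedding ι ∧ x ∈ range ι) {F : Set X}
    (hF : HasLinearComponents F) : interior F = ∅ := by
  by_contra hne
  obtain ⟨x, hx⟩ := nonempty_iff_ne_empty.2 hne
  obtain ⟨ι, hι, p, rfl⟩ := hX x
  obtain ⟨r, hr, hball⟩ := Metric.mem_nhds_iff.1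
    ((isOpen_interior.preimage hι.continuous).mem_nhds hx)
  let e := OpenPartialHomeomorph.univBall p r
  have heball : ∀ z, e z ∈ Metric.ball p r := fun z => by
    rw [← OpenPartialHomeomorph.univBall_target p hr]
    exact e.map_source (by simp [e])
  let f : E → F := fun z => ⟨ι (e z), interior_subset (hball (heball z))⟩
  have hf : Continuous f :=
    Continuous.subtype_mk (hι.continuous.comp (OpenPartialHomeomorph.continuous_univBall p r)) _
  have hfinj : Function.Injective f := fun z z' h => by
    have h1 := hι.injective (congrArg Subtype.val h)
    exact e.injOn (by simp [e]) (by simp [e]) h1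
  obtain ⟨h, hh, hinj⟩ := hF (f 0)
  have hmem : ∀ z, f z ∈ connectedComponent (f 0) := fun z =>
    (isPreconnected_range hf).subset_connectedComponent (mem_range_self 0) (mem_range_self z)
  refine not_injective_of_one_lt_rank hE (f := fun z => h (f z))
    (hh.comp_continuous hf hmem) fun z z' hz => hfinj (hinj (hmem z) (hmem z') hz)

theorem exists_mem_closure_inter_closure {X : Type*} [TopologicalSpace X] [PreconnectedSpace X]
    {F : Set X} (hF : IsClosed F) (hint : interior F = ∅) (hcon : ¬ IsPreconnected Fᶜ) :
    ∃ P Q : Set X, IsOpen P ∧ IsOpen Q ∧ Disjoint P Q ∧ P ∪ Q = Fᶜ ∧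
      ∃ x, x ∈ closure P ∧ x ∈ closure Q := by
  simp only [IsPreconnected, not_forall, not_nonempty_iff_eq_empty] at hcon
  obtain ⟨u, v, hu, hv, huv, ⟨p, hp⟩, ⟨q, hq⟩, hemp⟩ := hcon
  have hunion : Fᶜ ∩ u ∪ Fᶜ ∩ v = Fᶜ := by
    rw [← inter_union_distrib_left, inter_eq_left]; exact huv
  refine ⟨Fᶜ ∩ u, Fᶜ ∩ v, hF.isOpen_compl.inter hu, hF.isOpen_compl.inter hv, ?_, hunion, ?_⟩
  · rw [disjoint_iff_inter_eq_empty, ← inter_inter_distrib_left, hemp]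
  · have hcl : closure (Fᶜ ∩ u) ∪ closure (Fᶜ ∩ v) = univ := by
      rw [← closure_union, hunion, closure_compl, hint, compl_empty]
    obtain ⟨x, -, hx⟩ := isPreconnected_closed_iff.1 (isPreconnected_univ (α := X)) _ _
      isClosed_closure isClosed_closure hcl.ge ⟨p, mem_univ p, subset_closure hp⟩
      ⟨q, mem_univ q, subset_closure hq⟩
    exact ⟨x, hx⟩

theorem tendsto_quotient_cocompact (a b : ℂ) :
    Tendsto (fun z : ℂ => (z - a) * star (z - b) / (1 + ‖z‖ ^ 2 : ℝ)) (cocompact ℂ) (𝓝 1) := by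
  have hinv : Tendsto (fun z : ℂ => z⁻¹) (cocompact ℂ) (𝓝 0) := by
    rw [← Metric.cobounded_eq_cocompact]; exact tendsto_inv₀_cobounded
  have h1 : ∀ c : ℂ, Tendsto (fun z : ℂ => 1 - c * z⁻¹) (cocompact ℂ) (𝓝 1) := fun c => by
    simpa using (hinv.const_mul c).const_sub 1
  have h2 : Tendsto (fun z : ℂ => (1 + (‖z⁻¹‖ ^ 2 : ℝ) : ℂ)⁻¹) (cocompact ℂ) (𝓝 1) := by
    have : Tendsto (fun z : ℂ => ((‖z⁻¹‖ ^ 2 : ℝ) : ℂ)) (cocompact ℂ) (𝓝 0) := by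
      have := (Complex.continuous_ofReal.tendsto _).comp (hinv.norm.pow 2)
      simpa [Function.comp_def] using this
    simpa using (this.const_add 1).inv₀ (by simp)
  have h3 := ((h1 a).mul (h1 b).star).mul h2
  simp only [star_one, mul_one] at h3
  refine h3.congr' ?_
  filter_upwards [isCompact_singleton (x := (0 : ℂ)).compl_mem_cocompact] with z hz
  have hz : z ≠ 0 := hz
  have hz' : star z ≠ 0 := star_ne_zero.2 hz
  have e1 : z - a = z * (1 - a * z⁻¹) := by field_simp
  have e2 : z - b = z * (1 - b * z⁻¹) := by field_simp
  have e3 : ((1 + ‖z‖ ^ 2 : ℝ) : ℂ) = (z * star z) * (1 + (‖z⁻¹‖ ^ 2 : ℝ)) := by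
    have hn : ‖z‖ ≠ 0 := norm_ne_zero_iff.2 hz
    have : z * star z = (‖z‖ ^ 2 : ℝ) := by
      rw [RCLike.star_def, Complex.mul_conj, Complex.normSq_eq_norm_sq]
    rw [this, norm_inv]
    norm_cast
    field_simp
    ring
  have hne : (1 + (‖z⁻¹‖ ^ 2 : ℝ) : ℂ) ≠ 0 := by
    have : (0 : ℝ) < 1 + ‖z⁻¹‖ ^ 2 := by positivity
    exact_mod_cast this.ne'
  conv_rhs => rw [e3, e1, e2, star_mul]
  field_simp

/-- On a compact connected surface, a closed set with linear components does not separate. -/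
theorem isPreconnected_compl_of_surface {X : Type*} [TopologicalSpace X] [T2Space X]
    [CompactSpace X] [PreconnectedSpace X]
    (hX : ∀ x : X, ∃ ι : ℂ → X, IsOpenEmbedding ι ∧ x ∈ range ι) {F : Set X} (hF : IsClosed F)
    (hlin : HasLinearComponents F) : IsPreconnected Fᶜ := by
  by_contra hcon
  have hint : interior F = ∅ :=
    interior_eq_empty_of_hasLinearComponents (by simp) hX hlin
  obtain ⟨P, Q, hP, hQ, hdisj, hPQ, x, hxP, hxQ⟩ := exists_mem_closure_inter_closure hF hint hcon
  obtain ⟨ι, hι, hx⟩ := hX x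
  obtain ⟨_, ⟨a, rfl⟩, haP⟩ := mem_closure_iff.1 hxP _ hι.isOpen_range hx
  obtain ⟨_, ⟨b, rfl⟩, hbQ⟩ := mem_closure_iff.1 hxQ _ hι.isOpen_range hx
  have hab : ι a ≠ ι b := fun h => disjoint_left.1 hdisj haP (h ▸ hbQ)
  have haF : ι a ∉ F := hPQ.le (Or.inl haP)
  have hbF : ι b ∉ F := hPQ.le (Or.inr hbQ)
  let g : ℂ → ℂ := fun z => (z - a) * star (z - b) / (1 + ‖z‖ ^ 2 : ℝ)
  have hden : ∀ z : ℂ, ((1 + ‖z‖ ^ 2 : ℝ) : ℂ) ≠ 0 := fun z => by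
    have : (0 : ℝ) < 1 + ‖z‖ ^ 2 := by positivity
    exact_mod_cast this.ne'
  have hg : Continuous g := Continuous.div (by fun_prop) (by fun_prop) hden
  let Φ : X → ℂ := Function.extend ι g fun _ => 1
  have hΦ : Continuous Φ := hι.continuous_extend_one hg (tendsto_quotient_cocompact a b)
  have hΦι : ∀ z, Φ (ι z) = g z := fun z => hι.injective.extend_apply _ _ z
  have hΦ0 : ∀ y, Φ y = 0 → y = ι a ∨ y = ι b := fun y hy => by
    by_cases hyr : y ∈ range ι
    · obtain ⟨z, rfl⟩ := hyr
      rw [hΦι] at hy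
      rcases mul_eq_zero.1 ((div_eq_zero_iff.1 hy).resolve_right (hden z)) with h | h
      · exact Or.inl (by rw [sub_eq_zero.1 h])
      · exact Or.inr (by rw [sub_eq_zero.1 (star_eq_zero.1 h)])
    · have : Φ y = 1 := Function.extend_apply' _ _ _ (by simpa using hyr)
      exact absurd (this.symm.trans hy) one_ne_zero
  have : CompactSpace F := isCompact_iff_compactSpace.1 hF.isCompact
  obtain ⟨g₀, hg₀, hg₀Φ⟩ := hlin.exists_exp_eq (φ := fun y : F => Φ y) (by fun_prop) (fun y h => by
    rcases hΦ0 y h with h | h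
    · exact haF (h ▸ y.2)
    · exact hbF (h ▸ y.2))
  obtain ⟨G, hG⟩ := ContinuousMap.exists_restrict_eq hF ⟨g₀, hg₀⟩
  have hGΦ : ∀ y ∈ F, Complex.exp (G y) = Φ y := fun y hy => by
    rw [← hg₀Φ ⟨y, hy⟩]
    exact congrArg Complex.exp (DFunLike.congr_fun hG ⟨y, hy⟩)
  let W : X → ℂ := fun y => Φ y * Complex.exp (-((G y).im * Complex.I))
  have hW : Continuous W := by fun_prop
  have hWF : ∀ y ∈ F, W y = ‖W y‖ := fun y hy => by
    have : W y = (Real.exp (G y).re : ℝ) := by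
      simp only [W]
      rw [← hGΦ y hy, ← Complex.exp_add, Complex.ofReal_exp]
      congr 1
      rw [← sub_eq_add_neg, sub_eq_iff_eq_add, Complex.re_add_im]
    rw [this, Complex.norm_real, Real.norm_of_nonneg (Real.exp_pos _).le]
  have hW0 : ∀ y, W y = 0 → y = ι a ∨ y = ι b := fun y hy =>
    hΦ0 y ((mul_eq_zero.1 hy).resolve_right (Complex.exp_ne_zero _))
  classical
  let w : X → ℂ := Q.piecewise (fun y => (‖W y‖ : ℂ)) W
  have hw : Continuous w := by
    refine Continuous.piecewise (fun y hy => (hWF y ?_).symm) (by fun_prop) hW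
    by_contra hyF
    have hyPQ : y ∈ P ∪ Q := hPQ.ge hyF
    rcases hyPQ with h | h
    · exact disjoint_left.1 (hdisj.closure_right hP) h hy.1
    · exact hy.2 (hQ.interior_eq.symm ▸ h)
  have hw0 : ∀ y, w y = 0 → y = ι a ∨ y = ι b := fun y hy => by
    refine hW0 y ?_
    by_cases h : y ∈ Q
    · rw [show w y = ‖W y‖ from piecewise_eq_of_mem _ _ _ h] at hy
      simpa using hy
    · rwa [show w y = W y from piecewise_eq_of_notMem _ _ _ h] at hy
  have hwfin : {y | w y = 0}.Finite := (toFinite {ι a, ι b}).subset fun y hy => hw0 y hy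
  have heven := even_ncard_not_hasLocalSqrt hX hw hwfin
  have hset : {y | ¬ HasLocalSqrt w y} = {ι a} := by
    ext y
    simp only [mem_ofPred_eq, mem_singleton_iff]
    constructor
    · intro hy
      by_contra hya
      by_cases hyb : y = ι b
      · refine hy (hasLocalSqrt_of_nonneg hw (eventually_nhdsWithin_of_eventually_nhds ?_))
        filter_upwards [hQ.mem_nhds (hyb ▸ hbQ)] with t ht
        rw [show w t = ‖W t‖ from piecewise_eq_of_mem _ _ _ ht]
        simp
      · exact hy (hasLocalSqrt_of_ne_zero (Eventually.of_forall fun _ => hw.continuousAt)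
          fun h => (hw0 y h).elim hya hyb)
    · rintro rfl h
      rw [← hasLocalSqrt_comp_iff hι] at h
      have hab' : a ≠ b := fun h => hab (h ▸ rfl)
      let c : ℂ → ℂ := fun z =>
        Complex.exp ((G (ι z)).im * Complex.I) * (1 + ‖z‖ ^ 2 : ℝ) / star (z - b)
      have hιc := hι.continuous
      have hc : ∀ z, z ≠ b → ContinuousAt c z := fun z hz =>
        ContinuousAt.div (by fun_prop) (by fun_prop) (star_ne_zero.2 (sub_ne_zero.2 hz))
      have hev : ∀ᶠ z in 𝓝 a, z ≠ b := isOpen_ne.mem_nhds hab'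
      have hcs : HasLocalSqrt c a := by
        refine hasLocalSqrt_of_ne_zero (hev.mono hc) ?_
        exact div_ne_zero (mul_ne_zero (Complex.exp_ne_zero _) (hden a))
          (star_ne_zero.2 (sub_ne_zero.2 hab'))
      refine not_hasLocalSqrt_sub a ((h.mul hcs).congr ?_)
      refine eventually_nhdsWithin_of_eventually_nhds ?_
      filter_upwards [hev, hιc.continuousAt.preimage_mem_nhds (hP.mem_nhds haP)] with z hzb hzP
      have hzQ : ι z ∉ Q := fun hzQ => disjoint_left.1 hdisj hzP hzQ
      have hs := star_ne_zero.2 (sub_ne_zero.2 hzb)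
      have hd := hden z
      have he := Complex.exp_ne_zero ((G (ι z)).im * Complex.I)
      rw [show w (ι z) = W (ι z) from piecewise_eq_of_notMem _ _ _ hzQ]
      simp only [W, c, hΦι, g, Complex.exp_neg]
      field_simp
  rw [hset, ncard_singleton] at heven
  exact Nat.not_even_one heven

theorem exists_chart_sphere (x : Metric.sphere (0 : EuclideanSpace ℝ (Fin 3)) 1) :
    ∃ ι : ℂ → Metric.sphere (0 : EuclideanSpace ℝ (Fin 3)) 1, IsOpenEmbedding ι ∧ x ∈ range ι := by
  have : Fact (Module.finrank ℝ (EuclideanSpace ℝ (Fin 3)) = 2 + 1) := ⟨by simp⟩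
  let e := (stereographic' 2 (-x)).symm
  have he : e.source = univ := stereographic'_target (-x)
  refine ⟨e ∘ Complex.orthonormalBasisOneI.repr, (e.isOpenEmbedding he).comp
    Complex.orthonormalBasisOneI.repr.toHomeomorph.isOpenEmbedding, ?_⟩
  rw [range_comp, Complex.orthonormalBasisOneI.repr.surjective.range_eq, ← he,
    e.image_source_eq_target]
  show x ∈ (stereographic' 2 (-x)).source
  rw [stereographic'_source]
  intro h
  rw [mem_singleton_iff] at h
  exact ne_neg_of_mem_unit_sphere ℝ x h

theorem exists_injective_linearMap_apply_eq {V E : Type*} [AddCommGroup V] [Module ℝ V]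
    [Module.Finite ℝ V] [NormedAddCommGroup E] [NormedSpace ℝ E] [Module.Finite ℝ E]
    (hVE : Module.finrank ℝ V ≤ Module.finrank ℝ E) {e : V} (he : e ≠ 0) {d : E} (hd : d ≠ 0) :
    ∃ T : V →ₗ[ℝ] E, Function.Injective T ∧ T e = d := by
  obtain ⟨T, hT⟩ := finrank_le_iff_exists_linearMap.1 hVE
  obtain ⟨A, hA⟩ := SeparatingDual.exists_continuousLinearEquiv_apply_eq (R := ℝ)
    (show T e ≠ 0 from (map_ne_zero_iff T hT).2 he) hd
  exact ⟨A.toLinearEquiv.toLinearMap ∘ₗ T, A.injective.comp hT, hA⟩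

theorem isPreconnected_compl_of_euclidean {n : ℕ} (hn : 3 ≤ n)
    {K : Set (EuclideanSpace ℝ (Fin n))} (hK : IsClosed K) (hlin : HasLinearComponents K) :
    IsPreconnected Kᶜ := by
  refine isPreconnected_of_forall_pair fun x hx y hy => ?_
  rcases eq_or_ne x y with rfl | hxy
  · exact ⟨{x}, by simpa using hx, rfl, rfl, isPreconnected_singleton⟩
  let e : EuclideanSpace ℝ (Fin 3) := EuclideanSpace.single 0 1
  have he : ‖e‖ = 1 := by simp [e]
  have he0 : e ≠ 0 := by rw [← norm_ne_zero_iff, he]; exact one_ne_zero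
  obtain ⟨T, hT, hTe⟩ := exists_injective_linearMap_apply_eq (e := e)
    (E := EuclideanSpace ℝ (Fin n)) (by simpa using hn) he0
    (d := (2⁻¹ : ℝ) • (x - y)) (smul_ne_zero (by norm_num) (sub_ne_zero.2 hxy))
  have hTc : Continuous T := T.continuous_of_finiteDimensional
  let f : Metric.sphere (0 : EuclideanSpace ℝ (Fin 3)) 1 → EuclideanSpace ℝ (Fin n) :=
    fun s => (2⁻¹ : ℝ) • (x + y) + T s
  have hf : Continuous f := by fun_prop
  have hfinj : Function.Injective f := fun s t h =>
    Subtype.ext (hT (add_left_cancel h))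
  have : PreconnectedSpace (Metric.sphere (0 : EuclideanSpace ℝ (Fin 3)) 1) :=
    isPreconnected_iff_preconnectedSpace.1
      (isPreconnected_sphere (by rw [← Module.finrank_eq_rank]; simp) 0 1)
  have hlin' : HasLinearComponents (f ⁻¹' K) :=
    hlin.of_injective (f := fun s => ⟨f s.1, s.2⟩) (by fun_prop)
      fun s t h => Subtype.ext (hfinj (congrArg Subtype.val h))
  have hcon := isPreconnected_compl_of_surface exists_chart_sphere (hK.preimage hf) hlin'
  have h1 : f ⟨e, by simpa using he⟩ = x := by
    simp only [f, hTe]; module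
  have h2 : f ⟨-e, by simpa using he⟩ = y := by
    simp only [f, map_neg, hTe]; module
  refine ⟨f '' (f ⁻¹' K)ᶜ, ?_, ⟨_, ?_, h1⟩, ⟨_, ?_, h2⟩, hcon.image f hf.continuousOn⟩
  · rintro _ ⟨s, hs, rfl⟩; exact hs
  · simpa [h1] using hx
  · simpa [h2] using hy

theorem isPreconnected_compl_of_three_le {X : Type*} [TopologicalSpace X] [PreconnectedSpace X]
    {n : ℕ} (hn : 3 ≤ n)
    (hX : ∀ x : X, ∃ ι : EuclideanSpace ℝ (Fin n) → X, IsOpenEmbedding ι ∧ x ∈ range ι)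
    {F : Set X} (hF : IsClosed F) (hlin : HasLinearComponents F) (hint : interior F = ∅) :
    IsPreconnected Fᶜ := by
  by_contra hcon
  obtain ⟨P, Q, hP, hQ, hdisj, hPQ, x, hxP, hxQ⟩ := exists_mem_closure_inter_closure hF hint hcon
  obtain ⟨ι, hι, hx⟩ := hX x
  obtain ⟨_, ⟨a, rfl⟩, haP⟩ := mem_closure_iff.1 hxP _ hι.isOpen_range hx
  obtain ⟨_, ⟨b, rfl⟩, hbQ⟩ := mem_closure_iff.1 hxQ _ hι.isOpen_range hx
  have hιc := hι.continuous
  have hlin' : HasLinearComponents (ι ⁻¹' F) :=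
    hlin.of_injective (f := fun s => ⟨ι s.1, s.2⟩) (by fun_prop)
      fun s t h => Subtype.ext (hι.injective (congrArg Subtype.val h))
  have hpre := isPreconnected_compl_of_euclidean hn (hF.preimage hιc) hlin'
  obtain ⟨z, -, hzP, hzQ⟩ := hpre (ι ⁻¹' P) (ι ⁻¹' Q) (hP.preimage hιc) (hQ.preimage hιc)
    (fun z hz => hPQ.ge hz) ⟨a, hPQ.le (Or.inl haP), haP⟩ ⟨b, hPQ.le (Or.inr hbQ), hbQ⟩
  exact disjoint_left.1 hdisj hzP hzQ

theorem IsFence.hasLinearComponents {X : Type*} [TopologicalSpace X] {F : Set X}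
    (hF : IsFence F) : HasLinearComponents F := by
  intro x
  obtain ⟨a, b, -, ⟨e⟩⟩ := hF.2.2 x x.2
  have hmem : ∀ y ∈ connectedComponent x, (y : X) ∈ connectedComponentIn F x := fun y hy => by
    rw [connectedComponentIn_eq_image x.2]; exact ⟨y, hy, rfl⟩
  classical
  let h : F → ℝ := fun y =>
    if hy : (y : X) ∈ connectedComponentIn F x then e ⟨y, hy⟩ else 0
  have hh : ∀ y (hy : y ∈ connectedComponent x), h y = e ⟨y, hmem y hy⟩ := fun y hy =>
    dif_pos (hmem y hy)
  refine ⟨h, ?_, fun y hy z hz hyz => ?_⟩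
  · rw [continuousOn_iff_continuous_domRestrict]
    have : (connectedComponent x).domRestrict h =
        fun y : connectedComponent x => (e ⟨y, hmem y y.2⟩ : ℝ) :=
      funext fun y => hh y y.2
    rw [this]
    fun_prop
  · rw [hh y hy, hh z hz] at hyz
    have := e.injective (Subtype.ext hyz)
    exact Subtype.ext (congrArg (fun t : connectedComponentIn F x => (t : X)) this)

end

/-- For any fence `F` in a connected closed `n`-manifold `X` of dimension `n ≥ 2`
(a compact metrizable space each of whose points has an open neighborhood homeomorphic
to `ℝⁿ`), the complement `X \ F` is connected and nonempty. -/
theorem compl_fence_connected {X : Type*} [TopologicalSpace X] [CompactSpace X]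
    [TopologicalSpace.MetrizableSpace X] [ConnectedSpace X] (n : ℕ) (hn : 2 ≤ n)
    (hX : ∀ x : X, ∃ U : Set X, IsOpen U ∧ x ∈ U ∧
      Nonempty (U ≃ₜ EuclideanSpace ℝ (Fin n)))
    (F : Set X) (hF : IsFence F) :
    IsConnected (Fᶜ) := by
  have hchart : ∀ x : X, ∃ ι : EuclideanSpace ℝ (Fin n) → X,
      Topology.IsOpenEmbedding ι ∧ x ∈ Set.range ι := fun x => by
    obtain ⟨U, hU, hxU, ⟨e⟩⟩ := hX x
    exact ⟨fun z => e.symm z, hU.isOpenEmbedding_subtypeVal.comp e.symm.isOpenEmbedding,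
      e ⟨x, hxU⟩, by simp⟩
  have hlin := hF.hasLinearComponents
  have hint : interior F = ∅ := interior_eq_empty_of_hasLinearComponents
    (E := EuclideanSpace ℝ (Fin n)) (by rw [← Module.finrank_eq_rank]; simp; omega)
    hchart hlin
  have hcl : IsClosed F := hF.1.isClosed
  refine ⟨?_, ?_⟩
  · rw [Set.nonempty_compl]
    rintro rfl
    simp at hint
  · rcases hn.eq_or_lt with rfl | hn
    · refine isPreconnected_compl_of_surface (fun x => ?_) hcl hlin
      obtain ⟨ι, hι, hx⟩ := hchart x
      refine ⟨ι ∘ Complex.orthonormalBasisOneI.repr, hι.comp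
        Complex.orthonormalBasisOneI.repr.toHomeomorph.isOpenEmbedding, ?_⟩
      rwa [Set.range_comp, Complex.orthonormalBasisOneI.repr.surjective.range_eq, Set.image_univ]
    · exact isPreconnected_compl_of_three_le hn hchart hcl hlin hint
end
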